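/- Let a = 0 and ε > 0 be sufficiently small. Then every global minimizer of E can be written, after composing with a rotation g ∈ SO(2) in the target, as v(x) = (v_rad(|x|), 0) with v_rad ∈ C^∞(ℝ) positive on ℝ; the global minimizer is unique up to replacing v by gv, g ∈ SO(2). -/

import Mathlib

open MeasureTheory Filter Real Set
open scoped Topology ENNReal

noncomputable section

/-- We identify the plane with the Euclidean space `ℝ²`. -/
abbrev E2 : Type := EuclideanSpace ℝ (Fin 2)

/-- The standard basis vectors of `ℝ²`. -/
def e2basis (i : Fin 2) : E2 := EuclideanSpace.single i 1

/-- Rotation of a vector by `π/2` (multiplication by `i` in complex notation). -/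
def perp (e : E2) : E2 := EuclideanSpace.single 0 (-(e 1)) + EuclideanSpace.single 1 (e 0)

/-- The unit vector `e^{iθ}`. -/
def uvec (θ : ℝ) : E2 := EuclideanSpace.single 0 (Real.cos θ) + EuclideanSpace.single 1 (Real.sin θ)

/-- The Laplacian of a map `u : ℝ² → ℝ²`. -/
def lap (u : E2 → E2) (x : E2) : E2 :=
  ∑ i : Fin 2, fderiv ℝ (fun y => fderiv ℝ u y (e2basis i)) x (e2basis i)

/-- `|∇u|²`, the squared Hilbert-Schmidt norm of the full gradient of `u : ℝ² → ℝ²`. -/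
def gradSq (u : E2 → E2) (x : E2) : ℝ := ∑ i : Fin 2, ‖fderiv ℝ u x (e2basis i)‖ ^ 2

/-- `∑_j ∇u_j · ∇ψ_j`, the Hilbert-Schmidt inner product of the gradients. -/
def gradInner (u ψ : E2 → E2) (x : E2) : ℝ :=
  ∑ i : Fin 2, (inner ℝ (fderiv ℝ u x (e2basis i)) (fderiv ℝ ψ x (e2basis i)) : ℝ)

/-- Membership in `H¹(ℝ²,ℝ²)`: `u ∈ L²` together with its gradient. -/
def MemH1 (u : E2 → E2) : Prop :=
  Differentiable ℝ u ∧ MemLp u 2 (volume : Measure E2) ∧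
    MemLp (fun x => fderiv ℝ u x) 2 (volume : Measure E2)

/-- The Ginzburg–Landau energy
`E(u) = ∫ (1/2)|∇u|² − (1/(2ε²))μ|u|² + (1/(4ε²))|u|⁴ − (a/ε) f·u`. -/
def energy (ε a : ℝ) (μ : E2 → ℝ) (f : E2 → E2) (u : E2 → E2) : ℝ :=
  ∫ x : E2, ((1/2) * gradSq u x - (1/(2*ε^2)) * μ x * ‖u x‖^2
    + (1/(4*ε^2)) * ‖u x‖^4 - (a/ε) * (inner ℝ (f x) (u x) : ℝ))

/-- `v` is a global minimizer of `E` over `H¹(ℝ²,ℝ²)`. -/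
def IsMinimizer (ε a : ℝ) (μ : E2 → ℝ) (f : E2 → E2) (v : E2 → E2) : Prop :=
  MemH1 v ∧ ∀ u : E2 → E2, MemH1 u → energy ε a μ f v ≤ energy ε a μ f u

/-- `u` is a smooth classical solution of the Euler–Lagrange equation
`ε²Δu + μu − |u|²u + εa f = 0` on `ℝ²`. -/
def IsSolution (ε a : ℝ) (μ : E2 → ℝ) (f : E2 → E2) (u : E2 → E2) : Prop :=
  ContDiff ℝ (⊤ : ℕ∞) u ∧ ∀ x : E2, ε^2 • lap u x + μ x • u x - ‖u x‖^2 • u x + (ε*a) • f x = 0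

/-- Hypotheses on the radial coefficient `μ`. -/
structure MuHyp (μ : E2 → ℝ) (μrad : ℝ → ℝ) (ρ : ℝ) : Prop where
  smooth : ContDiff ℝ (⊤ : ℕ∞) μ
  smooth_rad : ContDiff ℝ (⊤ : ℕ∞) μrad
  even_rad : ∀ r : ℝ, μrad (-r) = μrad r
  radial : ∀ x : E2, μ x = μrad ‖x‖
  bdd : ∃ C : ℝ, ∀ x : E2, |μ x| ≤ C
  deriv_neg : ∀ r : ℝ, 0 < r → deriv μrad r < 0
  rho_pos : 0 < ρ
  rho_root : μrad ρ = 0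
  rho_unique : ∀ r : ℝ, 0 < r → μrad r = 0 → r = ρ

/-- Hypotheses on the radial vector field `f`. -/
structure FHyp (f : E2 → E2) (frad : ℝ → ℝ) : Prop where
  smooth : ContDiff ℝ (⊤ : ℕ∞) f
  smooth_rad : ContDiff ℝ (⊤ : ℕ∞) frad
  odd_rad : ∀ r : ℝ, frad (-r) = -frad r
  radial : ∀ x : E2, x ≠ 0 → f x = (frad ‖x‖ / ‖x‖) • x
  integrable : Integrable f (volume : Measure E2)
  bdd : ∃ C : ℝ, ∀ x : E2, ‖f x‖ ≤ C
  pos_rad : ∀ r : ℝ, 0 < r → 0 < frad r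

/-- Convergence in `C²_loc(ℝ²,ℝ²)` of a sequence of maps. -/
def TendstoC2LocSeq (F : ℕ → E2 → E2) (g : E2 → E2) : Prop :=
  TendstoLocallyUniformly F g atTop ∧
  TendstoLocallyUniformly (fun n x => fderiv ℝ (F n) x) (fun x => fderiv ℝ g x) atTop ∧
  TendstoLocallyUniformly (fun n x => fderiv ℝ (fderiv ℝ (F n)) x)
    (fun x => fderiv ℝ (fderiv ℝ g) x) atTop

/-- `l` is a limit point (as `ε → 0`) of the set of zeros of the family `v ε`. -/
def IsZeroLimitPoint (v : ℝ → E2 → E2) (l : E2) : Prop :=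
  ∃ (εs : ℕ → ℝ) (xs : ℕ → E2), (∀ n, 0 < εs n) ∧ Tendsto εs atTop (𝓝 (0:ℝ)) ∧
    (∀ n, v (εs n) (xs n) = 0) ∧ Tendsto xs atTop (𝓝 l)

/-- Averaging operator `s ↦ ∫₀¹ τ^k G(sτ) dτ`. -/
def avgOp (k : ℕ) (G : ℝ → ℝ) (s : ℝ) : ℝ := ∫ τ in (0:ℝ)..1, τ ^ k * G (s * τ)

lemma avgOp_continuous (k : ℕ) (G : ℝ → ℝ) (hG : Continuous G) : Continuous (avgOp k G) := by
  unfold avgOp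
  apply intervalIntegral.continuous_parametric_intervalIntegral_of_continuous'
  simp only [Function.uncurry_def]
  fun_prop

lemma avgOp_hasDerivAt (k : ℕ) (G : ℝ → ℝ) (hG : ContDiff ℝ 1 G) (s : ℝ) :
    HasDerivAt (avgOp k G) (avgOp (k+1) (deriv G) s) s := by
  have hc : Continuous G := hG.continuous
  have hd : Continuous (deriv G) := hG.continuous_deriv le_rfl
  obtain ⟨C, hC⟩ := (isCompact_Icc (a := -(|s|+1)) (b := |s|+1)).exists_bound_of_continuousOn
    hd.continuousOn
  have := (intervalIntegral.hasDerivAt_integral_of_dominated_loc_of_deriv_le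
    (μ := volume) (a := 0) (b := 1)
    (F := fun s τ => τ ^ k * G (s * τ)) (F' := fun s τ => τ ^ (k+1) * deriv G (s * τ))
    (x₀ := s) (s := Metric.ball s 1) (bound := fun _ => C) (Metric.ball_mem_nhds s one_pos)
    (Eventually.of_forall fun x => by
      apply Continuous.aestronglyMeasurable; fun_prop)
    (by apply Continuous.intervalIntegrable; fun_prop)
    (by apply Continuous.aestronglyMeasurable; fun_prop)
    (Eventually.of_forall fun τ hτ x hx => by
      rw [uIoc_of_le zero_le_one] at hτ
      have h1 : |x * τ| ≤ |s| + 1 := by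
        rw [abs_mul, abs_of_pos hτ.1]
        have : |x| ≤ |s| + 1 := by
          have h3 : |x - s| < 1 := by simpa [Real.dist_eq] using hx
          have := abs_sub_abs_le_abs_sub x s
          linarith
        nlinarith [abs_nonneg x, hτ.2, hτ.1]
      have h2 := hC (x * τ) (abs_le.mp h1)
      rw [norm_mul, norm_pow, Real.norm_eq_abs τ, abs_of_pos hτ.1]
      have h4 : τ ^ (k+1) ≤ 1 := pow_le_one₀ hτ.1.le hτ.2
      calc _ ≤ 1 * ‖deriv G (x * τ)‖ := by gcongr
        _ ≤ C := by simpa using h2)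
    (by simp)
    (Eventually.of_forall fun τ hτ x hx => by
      have h1 : HasDerivAt G (deriv G (x * τ)) (x * τ) :=
        (hG.differentiable one_ne_zero).differentiableAt.hasDerivAt
      have h2 : HasDerivAt (fun x => x * τ) τ x := by simpa using (hasDerivAt_id x).mul_const τ
      have := (h1.comp x h2).const_mul (τ ^ k)
      convert! this using 1
      ring)).2
  exact this

lemma avgOp_contDiff (n : ℕ) : ∀ (k : ℕ) (G : ℝ → ℝ), ContDiff ℝ n G → ContDiff ℝ n (avgOp k G) := by
  induction n with
  | zero =>
    intro k G hG
    exact contDiff_zero.2 (avgOp_continuous k G hG.continuous)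
  | succ n ih =>
    intro k G hG
    have h1 : ContDiff ℝ 1 G := hG.of_le (by exact_mod_cast (Nat.succ_le_succ (Nat.zero_le n)))
    have hd := avgOp_hasDerivAt k G h1
    have h2 : ContDiff ℝ n (deriv G) := by
      have := (contDiff_succ_iff_deriv (n := (n:WithTop ℕ∞))).1 (by exact_mod_cast hG)
      exact this.2.2
    have : ContDiff ℝ ((n:WithTop ℕ∞)+1) (avgOp k G) := by
      rw [contDiff_succ_iff_deriv]
      refine ⟨fun x => (hd x).differentiableAt, by simp, ?_⟩
      have : deriv (avgOp k G) = avgOp (k+1) (deriv G) := funext fun x => (hd x).deriv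
      rw [this]
      exact ih _ _ h2
    exact_mod_cast this

/-- the radial potential -/
def radPot (G : ℝ → ℝ) (r : ℝ) : ℝ := ∫ s in (0:ℝ)..r, s * avgOp 1 G s

lemma radPot_hasDerivAt (G : ℝ → ℝ) (hG : Continuous G) (r : ℝ) :
    HasDerivAt (radPot G) (r * avgOp 1 G r) r := by
  have : Continuous fun s => s * avgOp 1 G s := continuous_id.mul (avgOp_continuous 1 G hG)
  exact intervalIntegral.integral_hasDerivAt_right (this.intervalIntegrable _ _)
    (this.stronglyMeasurableAtFilter _ _) this.continuousAt

lemma avgOp_scale (G : ℝ → ℝ) (r : ℝ) :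
    r * (r * avgOp 1 G r) = ∫ t in (0:ℝ)..r, t * G t := by
  unfold avgOp
  have := intervalIntegral.smul_integral_comp_mul_left (a := 0) (b := 1) (fun t => t * G t) r
  simp only [mul_zero, mul_one, smul_eq_mul] at this
  rw [← this, ← intervalIntegral.integral_const_mul]
  congr 1
  congr 1
  ext τ
  ring

lemma radPot_even (G : ℝ → ℝ) (hG : ∀ r, G (-r) = G r) (r : ℝ) : radPot G (-r) = radPot G r := by
  unfold radPot
  have h := intervalIntegral.integral_comp_neg (a := 0) (b := r) (fun s => s * avgOp 1 G s)
  have h2 : ∀ s, avgOp 1 G (-s) = avgOp 1 G s := by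
    intro s; unfold avgOp; simp only [neg_mul, hG]
  simp only [h2, neg_zero] at h
  rw [intervalIntegral.integral_symm, ← h, ← intervalIntegral.integral_neg]
  simp

lemma smooth_of_integral_eq (h G : ℝ → ℝ) (c : ℝ) (hh : Continuous h)
    (hG : ∀ n : ℕ, ContDiff ℝ n h → ContDiff ℝ n G)
    (heq : ∀ r, h r = c + radPot G r) : ContDiff ℝ (⊤ : ℕ∞) h := by
  have hGc : Continuous G := (hG 0 (contDiff_zero.2 hh)).continuous
  have hd : ∀ r, HasDerivAt h (r * avgOp 1 G r) r := by
    intro r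
    have h1 : h = fun r => c + radPot G r := funext heq
    rw [h1]
    exact (radPot_hasDerivAt G hGc r).const_add c
  rw [contDiff_infty]
  intro n
  induction n with
  | zero => exact contDiff_zero.2 hh
  | succ n ih =>
    have : ContDiff ℝ ((n:WithTop ℕ∞)+1) h := by
      rw [contDiff_succ_iff_deriv]
      refine ⟨fun x => (hd x).differentiableAt, by simp, ?_⟩
      have : deriv h = fun r => r * avgOp 1 G r := funext fun x => (hd x).deriv
      rw [this]
      exact contDiff_id.mul (avgOp_contDiff n 1 G (hG n ih))
    exact_mod_cast this

/-- A nonnegative solution of the radial linear ODE vanishing somewhere vanishes identically. -/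
lemma zero_of_zero (h p : ℝ → ℝ) (c : ℝ) (hp : Continuous p) (hs : ContDiff ℝ (⊤ : ℕ∞) h)
    (hev : ∀ r, h (-r) = h r) (h0 : ∀ r, 0 ≤ h r)
    (heq : ∀ r, h r = c + radPot (fun r => p r * h r) r) (r0 : ℝ) (hr0 : h r0 = 0) :
    ∀ r, h r = 0 := by
  set G := fun r => p r * h r with hGdef
  have hGc : Continuous G := hp.mul hs.continuous
  have hs2 : ContDiff ℝ 2 h := by exact_mod_cast contDiff_infty.1 hs 2
  have hd1 : ∀ r, HasDerivAt h (deriv h r) r := fun r =>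
    (hs2.differentiable two_ne_zero).differentiableAt.hasDerivAt
  have hcd : ContDiff ℝ 1 (deriv h) :=
    ((contDiff_succ_iff_deriv (n := 1)).1 (by norm_num; exact hs2)).2.2
  have hd2 : ∀ r, HasDerivAt (deriv h) (deriv (deriv h) r) r := fun r =>
    (hcd.differentiable one_ne_zero).differentiableAt.hasDerivAt
  have hdh : ∀ r, deriv h r = r * avgOp 1 G r := by
    intro r
    have h1 : h = fun r => c + radPot G r := funext heq
    have := ((radPot_hasDerivAt G hGc r).const_add c).deriv
    rw [← h1] at this
    exact this
  have hode : ∀ r, deriv h r + r * deriv (deriv h) r = r * (p r * h r) := by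
    intro r
    have h1 : HasDerivAt (fun r => r * deriv h r) (1 * deriv h r + r * deriv (deriv h) r) r :=
      (hasDerivAt_id r).mul (hd2 r)
    have h2 : (fun r => r * deriv h r) = fun r => ∫ t in (0:ℝ)..r, t * G t := by
      ext r; rw [hdh, avgOp_scale]
    have hc : Continuous fun t => t * G t := continuous_id.mul hGc
    have h3 : HasDerivAt (fun r => ∫ t in (0:ℝ)..r, t * G t) (r * G r) r :=
      intervalIntegral.integral_hasDerivAt_right (hc.intervalIntegrable _ _)
        (hc.stronglyMeasurableAtFilter _ _) hc.continuousAt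
    rw [← h2] at h3
    have := h1.unique h3
    simpa using this
  -- zero of the derivative
  have hdz : ∀ r, h r = 0 → deriv h r = 0 := by
    intro r hr
    apply IsLocalMin.deriv_eq_zero
    exact Eventually.of_forall fun x => by simpa [hr] using h0 x
  set e : ℝ → ℝ := fun r => h r ^ 2 + deriv h r ^ 2 with he
  have hde : ∀ r, HasDerivAt e (2 * h r * deriv h r + 2 * deriv h r * deriv (deriv h) r) r := by
    intro r
    have := ((hd1 r).pow 2).add ((hd2 r).pow 2)
    convert! this using 1
    norm_num
  have he0 : ∀ r, 0 ≤ e r := fun r => by positivity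
  have hez : ∀ r, h r = 0 → e r = 0 := fun r hr => by simp [he, hr, hdz r hr]
  -- forward
  have fwd : ∀ a b, 0 ≤ a → a ≤ b → h a = 0 → h b = 0 := by
    intro a b ha hab hza
    obtain ⟨C, hC⟩ := (isCompact_Icc (a := a) (b := b)).exists_bound_of_continuousOn hp.continuousOn
    have hE : ∀ r, HasDerivAt (fun r => e r * Real.exp (-(1 + C) * r))
      ((2 * h r * deriv h r + 2 * deriv h r * deriv (deriv h) r) * Real.exp (-(1 + C) * r)
        + e r * (Real.exp (-(1 + C) * r) * (-(1 + C)))) r := by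
      intro r
      refine (hde r).mul ?_
      have := ((hasDerivAt_id r).const_mul (-(1 + C))).exp
      simpa using this
    have hanti : AntitoneOn (fun r => e r * Real.exp (-(1 + C) * r)) (Icc a b) := by
      apply antitoneOn_of_deriv_nonpos (convex_Icc a b)
      · exact fun r _ => (hE r).continuousAt.continuousWithinAt
      · exact fun r _ => (hE r).differentiableAt.differentiableWithinAt
      · intro r hr
        rw [interior_Icc] at hr
        rw [(hE r).deriv]
        have hrp : 0 < r := lt_of_le_of_lt ha hr.1
        have hpr := abs_le.1 (hC r ⟨hr.1.le, hr.2.le⟩)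
        have h5 : 2 * h r * deriv h r + 2 * deriv h r * deriv (deriv h) r ≤ (1 + C) * e r := by
          have h6 : deriv (deriv h) r = p r * h r - deriv h r / r := by
            have := hode r
            field_simp
            linarith
          rw [h6]
          have h7 : 0 ≤ deriv h r * (deriv h r / r) := by
            rw [← mul_div_assoc]; exact div_nonneg (mul_self_nonneg _) hrp.le
          simp only [he]
          have h8 : 2 * h r * deriv h r ≤ h r ^ 2 + deriv h r ^ 2 := by
            nlinarith [sq_nonneg (h r - deriv h r)]
          have h9 : 2 * (p r * (h r * deriv h r)) ≤ C * (h r ^ 2 + deriv h r ^ 2) := by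
            nlinarith [mul_nonneg (sub_nonneg.2 hpr.2) (sq_nonneg (h r + deriv h r)),
              mul_nonneg (by linarith : 0 ≤ C + p r) (sq_nonneg (h r - deriv h r))]
          nlinarith
        have := Real.exp_pos (-(1 + C) * r)
        nlinarith
    have := hanti (left_mem_Icc.2 hab) (right_mem_Icc.2 hab) hab
    simp only [hez a hza, zero_mul] at this
    have h10 : e b ≤ 0 := by
      by_contra hcon
      push Not at hcon
      have := mul_pos hcon (Real.exp_pos (-(1 + C) * b))
      linarith
    have : h b ^ 2 ≤ 0 := by
      have : e b = h b ^ 2 + deriv h b ^ 2 := rfl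
      nlinarith [sq_nonneg (deriv h b)]
    exact pow_eq_zero_iff (two_ne_zero) |>.1 (le_antisymm this (sq_nonneg _))
  have bwd : ∀ a b, 0 < a → a ≤ b → h b = 0 → h a = 0 := by
    intro a b ha hab hza
    obtain ⟨C, hC⟩ := (isCompact_Icc (a := a) (b := b)).exists_bound_of_continuousOn hp.continuousOn
    have hE : ∀ r, HasDerivAt (fun r => e r * Real.exp ((1 + C + 2 / a) * r))
      ((2 * h r * deriv h r + 2 * deriv h r * deriv (deriv h) r) * Real.exp ((1 + C + 2 / a) * r)
        + e r * (Real.exp ((1 + C + 2 / a) * r) * ((1 + C + 2 / a)))) r := by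
      intro r
      refine (hde r).mul ?_
      have := ((hasDerivAt_id r).const_mul ((1 + C + 2 / a))).exp
      simpa using this
    have hanti : MonotoneOn (fun r => e r * Real.exp ((1 + C + 2 / a) * r)) (Icc a b) := by
      apply monotoneOn_of_deriv_nonneg (convex_Icc a b)
      · exact fun r _ => (hE r).continuousAt.continuousWithinAt
      · exact fun r _ => (hE r).differentiableAt.differentiableWithinAt
      · intro r hr
        rw [interior_Icc] at hr
        rw [(hE r).deriv]
        have hrp : 0 < r := lt_trans ha hr.1
        have hpr := abs_le.1 (hC r ⟨hr.1.le, hr.2.le⟩)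
        have h5 : -((1 + C + 2 / a) * e r) ≤
            2 * h r * deriv h r + 2 * deriv h r * deriv (deriv h) r := by
          have h6 : deriv (deriv h) r = p r * h r - deriv h r / r := by
            have := hode r
            field_simp
            linarith
          rw [h6]
          have h7 : deriv h r * (deriv h r / r) ≤ deriv h r ^ 2 / a := by
            rw [← mul_div_assoc, ← pow_two]
            exact div_le_div_of_nonneg_left (sq_nonneg _) ha hr.1.le
          simp only [he]
          have h8 : -(h r ^ 2 + deriv h r ^ 2) ≤ 2 * h r * deriv h r := by
            nlinarith [sq_nonneg (h r + deriv h r)]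
          have h9 : -(C * (h r ^ 2 + deriv h r ^ 2)) ≤ 2 * (p r * (h r * deriv h r)) := by
            nlinarith [mul_nonneg (sub_nonneg.2 hpr.2) (sq_nonneg (h r - deriv h r)),
              mul_nonneg (by linarith : 0 ≤ C + p r) (sq_nonneg (h r + deriv h r))]
          have h10 : 2 / a * (h r ^ 2 + deriv h r ^ 2)
              = 2 * (h r ^ 2 / a) + 2 * (deriv h r ^ 2 / a) := by ring
          have h11 : 0 ≤ h r ^ 2 / a := by positivity
          nlinarith
        have := Real.exp_pos ((1 + C + 2 / a) * r)
        nlinarith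
    have := hanti (left_mem_Icc.2 hab) (right_mem_Icc.2 hab) hab
    simp only [hez b hza, zero_mul] at this
    have h10 : e a ≤ 0 := by
      by_contra hcon
      push Not at hcon
      have := mul_pos hcon (Real.exp_pos ((1 + C + 2 / a) * a))
      linarith
    have : h a ^ 2 ≤ 0 := by
      have : e a = h a ^ 2 + deriv h a ^ 2 := rfl
      nlinarith [sq_nonneg (deriv h a)]
    exact pow_eq_zero_iff (two_ne_zero) |>.1 (le_antisymm this (sq_nonneg _))
  have habs : ∀ r, h |r| = h r := by
    intro r
    rcases abs_cases r with ⟨h1, _⟩ | ⟨h1, _⟩ <;> rw [h1]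
    exact hev r
  have hz : h |r0| = 0 := by rw [habs, hr0]
  have hpos : ∀ r, 0 < r → h r = 0 := by
    intro r hr
    rcases le_total (|r0|) r with h1 | h1
    · exact fwd _ _ (abs_nonneg _) h1 hz
    · exact bwd _ _ hr h1 hz
  intro r
  rw [← habs]
  rcases eq_or_lt_of_le (abs_nonneg r) with h1 | h1
  · rw [← h1]
    have hcl : IsClosed {r | h r = 0} := isClosed_eq hs.continuous continuous_const
    have : closure (Ioi (0:ℝ)) ⊆ {r | h r = 0} := hcl.closure_subset_iff.2 hpos
    rw [closure_Ioi] at this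
    exact this (by simp : (0:ℝ) ∈ Ici 0)
  · exact hpos _ h1

lemma weak_core (h G : ℝ → ℝ) (hh : Continuous h) (hG : Continuous G)
    (χ : ℝ → ℝ) (a R : ℝ) (hχ : Continuous χ) (ha : 0 < a) (haR : a < R)
    (hsupp : ∀ r, r ∉ Icc a R → χ r = 0) (hmean : ∫ r in (0:ℝ)..R, χ r = 0)
    (H : ∫ r in (0:ℝ)..R, (-(h r * χ r) +
        r * G r * (∫ s in R..r, (∫ t in (0:ℝ)..s, χ t) / s)) = 0) :
    ∫ r in (0:ℝ)..R, (h r - radPot G r) * χ r = 0 := by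
  set X : ℝ → ℝ := fun s => ∫ t in (0:ℝ)..s, χ t with hX
  have hXd : ∀ s, HasDerivAt X (χ s) s := fun s =>
    intervalIntegral.integral_hasDerivAt_right (hχ.intervalIntegrable _ _)
      (hχ.stronglyMeasurableAtFilter _ _) hχ.continuousAt
  have hXc : Continuous X := continuous_iff_continuousAt.2 fun s => (hXd s).continuousAt
  have hXz : ∀ s, s < a → X s = 0 := by
    intro s hs
    apply intervalIntegral.integral_zero_ae
    refine Eventually.of_forall fun t ht => hsupp t fun h => ?_
    have := ht.2
    have : t < a := lt_of_le_of_lt this (max_lt ha hs)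
    linarith [h.1]
  have hX0 : X 0 = 0 := hXz 0 ha
  have hXR : X R = 0 := hmean
  set κ : ℝ → ℝ := fun s => X s / s with hκ
  have hκc : Continuous κ := by
    rw [continuous_iff_continuousAt]
    intro s
    by_cases hs : s = 0
    · have : κ =ᶠ[𝓝 s] fun _ => 0 := by
        filter_upwards [Iio_mem_nhds (show s < a by rw [hs]; exact ha)] with y hy
        simp [hκ, hXz y hy]
      exact continuousAt_const.congr this.symm
    · exact hXc.continuousAt.div continuousAt_id hs
  set Φ : ℝ → ℝ := fun r => ∫ s in R..r, κ s with hΦ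
  have hΦd : ∀ s, HasDerivAt Φ (κ s) s := fun s =>
    intervalIntegral.integral_hasDerivAt_right (hκc.intervalIntegrable _ _)
      (hκc.stronglyMeasurableAtFilter _ _) hκc.continuousAt
  have hΦc : Continuous Φ := continuous_iff_continuousAt.2 fun s => (hΦd s).continuousAt
  have hΦR : Φ R = 0 := by simp [hΦ]
  have htG : Continuous fun t => t * G t := continuous_id.mul hG
  set Z : ℝ → ℝ := fun r => ∫ t in (0:ℝ)..r, t * G t with hZ
  have hZd : ∀ s, HasDerivAt Z (s * G s) s := fun s =>
    intervalIntegral.integral_hasDerivAt_right (htG.intervalIntegrable _ _)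
      (htG.stronglyMeasurableAtFilter _ _) htG.continuousAt
  have hZc : Continuous Z := continuous_iff_continuousAt.2 fun s => (hZd s).continuousAt
  have hZ0 : Z 0 = 0 := by simp [hZ]
  have hKc : Continuous (radPot G) :=
    continuous_iff_continuousAt.2 fun s => (radPot_hasDerivAt G hG s).continuousAt
  have hK'c : Continuous (fun r => r * avgOp 1 G r) := continuous_id.mul (avgOp_continuous 1 G hG)
  have i1 := intervalIntegral.integral_mul_deriv_eq_deriv_mul (a := 0) (b := R)
    (fun x _ => hΦd x) (fun x _ => hZd x) (hκc.intervalIntegrable _ _) (htG.intervalIntegrable _ _)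
  have i2 := intervalIntegral.integral_mul_deriv_eq_deriv_mul (a := 0) (b := R)
    (fun x _ => hXd x) (fun x _ => radPot_hasDerivAt G hG x) (hχ.intervalIntegrable _ _)
    (hK'c.intervalIntegrable _ _)
  rw [hΦR, hZ0] at i1
  rw [hXR, hX0] at i2
  have i3 : ∫ x in (0:ℝ)..R, κ x * Z x = ∫ x in (0:ℝ)..R, X x * (x * avgOp 1 G x) := by
    congr 1
    ext x
    have : Z x = x * (x * avgOp 1 G x) := (avgOp_scale G x).symm
    rw [this]
    by_cases hx : x = 0
    · simp [hx]
    · simp only [hκ]; field_simp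
  have e1 : ∫ r in (0:ℝ)..R, (-(h r * χ r) + r * G r * Φ r)
      = -(∫ r in (0:ℝ)..R, h r * χ r) + ∫ r in (0:ℝ)..R, Φ r * (r * G r) := by
    rw [← intervalIntegral.integral_neg, ← intervalIntegral.integral_add]
    · congr 1; ext r; ring
    · exact (Continuous.neg (hh.mul hχ)).intervalIntegrable _ _
    · exact (hΦc.mul htG).intervalIntegrable _ _
  have e2 : ∫ r in (0:ℝ)..R, (h r - radPot G r) * χ r =
      (∫ r in (0:ℝ)..R, h r * χ r) - ∫ r in (0:ℝ)..R, χ r * radPot G r := by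
    rw [← intervalIntegral.integral_sub]
    · congr 1; ext r; ring
    · exact (hh.mul hχ).intervalIntegrable _ _
    · exact (hχ.mul hKc).intervalIntegrable _ _
  have H' : ∫ r in (0:ℝ)..R, (-(h r * χ r) + r * G r * Φ r) = 0 := H
  rw [e1] at H'
  rw [e2]
  linarith

lemma integral_eq_of_weak (h G : ℝ → ℝ) (hh : Continuous h) (hG : Continuous G)
    (hev : ∀ r, h (-r) = h r) (hGev : ∀ r, G (-r) = G r)
    (H : ∀ (χ : ℝ → ℝ) (a R : ℝ), Continuous χ → 0 < a → a < R →
      (∀ r, r ∉ Icc a R → χ r = 0) → (∫ r in (0:ℝ)..R, χ r = 0) →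
      ∫ r in (0:ℝ)..R, (-(h r * χ r) +
        r * G r * (∫ s in R..r, (∫ t in (0:ℝ)..s, χ t) / s)) = 0) :
    ∃ c, ∀ r, h r = c + radPot G r := by
  have hKc : Continuous (radPot G) :=
    continuous_iff_continuousAt.2 fun s => (radPot_hasDerivAt G hG s).continuousAt
  set D : ℝ → ℝ := fun r => h r - radPot G r with hD
  have hDc : Continuous D := hh.sub hKc
  let b : ContDiffBump (2:ℝ) := ⟨1/2, 1, by norm_num, by norm_num⟩
  set χ0 : ℝ → ℝ := b.normed volume with hχ0
  have hχ0c : Continuous χ0 := b.continuous_normed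
  have hχ0i : ∫ x, χ0 x = 1 := b.integral_normed
  have hχ0s : ∀ r, r ∉ Icc (1:ℝ) 3 → χ0 r = 0 := by
    intro r hr
    by_contra hcon
    have h1 : r ∈ Function.support χ0 := hcon
    rw [hχ0, b.support_normed_eq] at h1
    have h2 : |r - 2| < 1 := by simpa [Real.dist_eq] using h1
    rw [abs_lt] at h2
    exact hr ⟨by linarith, by linarith⟩
  have hfull : ∀ (f : ℝ → ℝ) (a R : ℝ), 0 < a → a < R → (∀ r, r ∉ Icc a R → f r = 0) →
      ∫ x in (0:ℝ)..R, f x = ∫ x, f x := by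
    intro f a R ha haR hf
    apply intervalIntegral.integral_eq_integral_of_support_subset
    intro x hx
    by_contra hcon
    exact hx (hf x fun h => hcon ⟨by linarith [h.1], h.2⟩)
  set c := ∫ x, D x * χ0 x with hc
  have hcs0 : HasCompactSupport χ0 := b.hasCompactSupport_normed
  have hae : ∀ᵐ x ∂(volume : Measure ℝ), x ∈ Ioi (0:ℝ) → D x - c = 0 := by
    apply IsOpen.ae_eq_zero_of_integral_contDiff_smul_eq_zero isOpen_Ioi
    · exact (hDc.sub continuous_const).locallyIntegrable.locallyIntegrableOn _
    · intro g hg hgc hgs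
      have hgc' : Continuous g := hg.continuous
      obtain ⟨C, hC⟩ := hgc.isCompact.exists_bound_of_continuousOn (f := fun x : ℝ => x⁻¹)
        (fun x hx => (continuousAt_inv₀ (ne_of_gt (hgs hx))).continuousWithinAt)
      obtain ⟨B, hB⟩ := hgc.isCompact.exists_bound_of_continuousOn (f := fun x : ℝ => x)
        continuousOn_id
      set a := min 1 (|C|+1)⁻¹ with ha
      set R := max 3 B with hR
      have hCp : 0 < |C| + 1 := by positivity
      have hapos : 0 < a := lt_min one_pos (inv_pos.2 hCp)
      have haR : a < R := lt_of_le_of_lt (min_le_left _ _) (lt_of_lt_of_le (by norm_num) (le_max_left 3 B))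
      have hgz : ∀ r, r ∉ Icc a R → g r = 0 := by
        intro r hr
        by_contra hcon
        have hm : r ∈ tsupport g := subset_tsupport g hcon
        have hrp : 0 < r := hgs hm
        apply hr
        constructor
        · have h1 := hC r hm
          rw [norm_inv, Real.norm_of_nonneg hrp.le] at h1
          refine (min_le_right _ _).trans ?_
          rw [inv_le_comm₀ hCp hrp]
          linarith [le_abs_self C]
        · have h1 := hB r hm
          rw [Real.norm_of_nonneg hrp.le] at h1
          exact h1.trans (le_max_right _ _)
      set χ : ℝ → ℝ := fun r => g r - (∫ x, g x) * χ0 r with hχ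
      have hχc : Continuous χ := hgc'.sub (continuous_const.mul hχ0c)
      have hχz : ∀ r, r ∉ Icc a R → χ r = 0 := by
        intro r hr
        have : r ∉ Icc (1:ℝ) 3 := fun h =>
          hr ⟨(min_le_left _ _).trans h.1, h.2.trans (le_max_left _ _)⟩
        simp [hχ, hgz r hr, hχ0s r this]
      have gi : Integrable g := hgc'.integrable_of_hasCompactSupport hgc
      have χ0i : Integrable χ0 := hχ0c.integrable_of_hasCompactSupport hcs0
      have hm : ∫ r in (0:ℝ)..R, χ r = 0 := by
        rw [hfull χ a R hapos haR hχz]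
        simp only [hχ]
        rw [integral_sub gi (χ0i.const_mul _), integral_const_mul, hχ0i]
        ring
      have key := weak_core h G hh hG χ a R hχc hapos haR hχz hm
        (H χ a R hχc hapos haR hχz hm)
      rw [hfull _ a R hapos haR (fun r hr => by rw [hχz r hr, mul_zero])] at key
      have Dgi : Integrable (fun x => D x * g x) :=
        (hDc.mul hgc').integrable_of_hasCompactSupport hgc.mul_left
      have Dχi : Integrable (fun x => D x * χ0 x) :=
        (hDc.mul hχ0c).integrable_of_hasCompactSupport hcs0.mul_left
      have e1 : ∫ x, D x * χ x = (∫ x, D x * g x) - (∫ x, g x) * c := by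
        rw [hc, ← integral_const_mul, ← integral_sub Dgi (Dχi.const_mul _)]
        congr 1; ext x; simp only [hχ]; ring
      have e2 : ∫ x, g x • (D x - c) = (∫ x, D x * g x) - (∫ x, g x) * c := by
        rw [← integral_mul_const, ← integral_sub Dgi (gi.mul_const _)]
        congr 1; ext x; simp only [smul_eq_mul]; ring
      rw [e2, ← e1]
      exact key
  have hall : ∀ x ∈ Ici (0:ℝ), D x = c := by
    have h1 : EqOn D (fun _ => c) (Ioi 0) := by
      apply Measure.eqOn_open_of_ae_eq (μ := (volume : Measure ℝ)) _ isOpen_Ioi hDc.continuousOn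
        continuousOn_const
      rw [Filter.EventuallyEq, ae_restrict_iff' measurableSet_Ioi]
      filter_upwards [hae] with x hx hx'
      linarith [hx hx']
    have hcl : IsClosed {r | D r = c} := isClosed_eq hDc continuous_const
    have : closure (Ioi (0:ℝ)) ⊆ {r | D r = c} := hcl.closure_subset_iff.2 h1
    rw [closure_Ioi] at this
    exact this
  refine ⟨c, fun r => ?_⟩
  rcases le_total 0 r with hr | hr
  · have := hall r hr
    simp only [hD] at this
    linarith
  · have := hall (-r) (by simpa using hr)
    simp only [hD, hev, radPot_even G hGev] at this
    linarith

lemma norm_e2basis (i : Fin 2) : ‖e2basis i‖ = 1 := by simp [e2basis]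

lemma e2_expand (x : E2) : x = ∑ i : Fin 2, x i • e2basis i := by
  ext j
  fin_cases j <;> simp [e2basis]

lemma opNorm_sq_le {F : Type*} [NormedAddCommGroup F] [NormedSpace ℝ F] (L : E2 →L[ℝ] F) :
    ‖L‖ ^ 2 ≤ 2 * ∑ i : Fin 2, ‖L (e2basis i)‖ ^ 2 := by
  have h1 : ‖L‖ ≤ ‖L (e2basis 0)‖ + ‖L (e2basis 1)‖ := by
    apply L.opNorm_le_bound (by positivity)
    intro x
    have hx := e2_expand x
    rw [Fin.sum_univ_two] at hx
    have h2 : ∀ i, ‖x i‖ ≤ ‖x‖ := fun i => PiLp.norm_apply_le x i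
    calc ‖L x‖ = ‖x 0 • L (e2basis 0) + x 1 • L (e2basis 1)‖ := by
          conv_lhs => rw [hx]
          simp
      _ ≤ ‖x 0‖ * ‖L (e2basis 0)‖ + ‖x 1‖ * ‖L (e2basis 1)‖ := by
          refine (norm_add_le _ _).trans ?_
          rw [norm_smul, norm_smul]
      _ ≤ ‖x‖ * ‖L (e2basis 0)‖ + ‖x‖ * ‖L (e2basis 1)‖ := by
          gcongr <;> exact h2 _
      _ = _ := by ring
  rw [Fin.sum_univ_two]
  nlinarith [sq_nonneg (‖L (e2basis 0)‖ - ‖L (e2basis 1)‖), norm_nonneg L,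
    norm_nonneg (L (e2basis 0)), norm_nonneg (L (e2basis 1))]

/-- squared gradient of a scalar function -/
def sgrad (s : E2 → ℝ) (x : E2) : ℝ := ∑ i : Fin 2, (fderiv ℝ s x (e2basis i)) ^ 2

/-- scalar energy density -/
def sden (ε : ℝ) (μ : E2 → ℝ) (s : E2 → ℝ) (x : E2) : ℝ :=
  (1/2) * sgrad s x - (1/(2*ε^2)) * μ x * s x ^ 2 + (1/(4*ε^2)) * s x ^ 4

/-- vector energy density -/
def vden (ε : ℝ) (μ : E2 → ℝ) (v : E2 → E2) (x : E2) : ℝ :=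
  (1/2) * gradSq v x - (1/(2*ε^2)) * μ x * ‖v x‖ ^ 2 + (1/(4*ε^2)) * ‖v x‖ ^ 4

lemma energy_zero (ε : ℝ) (μ : E2 → ℝ) (f v : E2 → E2) :
    energy ε 0 μ f v = ∫ x, vden ε μ v x := by
  unfold energy vden
  simp

lemma measurable_sgrad (s : E2 → ℝ) : Measurable (sgrad s) := by
  unfold sgrad
  exact Finset.measurable_sum _ fun i _ => (measurable_fderiv_apply_const ℝ s (e2basis i)).pow_const 2

lemma measurable_gradSq (v : E2 → E2) : Measurable (gradSq v) := by
  unfold gradSq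
  exact Finset.measurable_sum _ fun i _ =>
    (measurable_fderiv_apply_const ℝ v (e2basis i)).norm.pow_const 2

lemma scalar_fderiv (s : E2 → ℝ) (hs : Differentiable ℝ s) (x y : E2) :
    fderiv ℝ (fun x => s x • e2basis 0) x y = fderiv ℝ s x y • e2basis 0 := by
  rw [fderiv_smul_const hs.differentiableAt]
  simp

lemma scalar_gradSq (s : E2 → ℝ) (hs : Differentiable ℝ s) (x : E2) :
    gradSq (fun x => s x • e2basis 0) x = sgrad s x := by
  unfold gradSq sgrad
  simp [scalar_fderiv s hs, norm_smul, norm_e2basis]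

lemma scalar_vden (ε : ℝ) (μ : E2 → ℝ) (s : E2 → ℝ) (hs : Differentiable ℝ s) (x : E2) :
    vden ε μ (fun x => s x • e2basis 0) x = sden ε μ s x := by
  unfold vden sden
  rw [scalar_gradSq s hs]
  have h4 : |s x| ^ 4 = s x ^ 4 := by
    rw [show (4:ℕ) = 2 * 2 from rfl, pow_mul, sq_abs, ← pow_mul]
  simp only [norm_smul, norm_e2basis, mul_one, Real.norm_eq_abs, sq_abs, h4]

lemma gradSq_integrable (v : E2 → E2) (hv : MemH1 v) : Integrable (gradSq v) := by
  have h1 := (memLp_two_iff_integrable_sq_norm hv.2.2.1).1 hv.2.2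
  refine (h1.const_mul 2).mono' (measurable_gradSq v).aestronglyMeasurable
    (Eventually.of_forall fun x => ?_)
  unfold gradSq
  rw [Real.norm_of_nonneg (Finset.sum_nonneg fun i _ => by positivity), Fin.sum_univ_two]
  have : ∀ i, ‖fderiv ℝ v x (e2basis i)‖ ^ 2 ≤ ‖fderiv ℝ v x‖ ^ 2 := by
    intro i
    have := (fderiv ℝ v x).le_opNorm (e2basis i)
    rw [norm_e2basis, mul_one] at this
    gcongr
  linarith [this 0, this 1]

lemma memH1_of (v : E2 → E2) (hd : Differentiable ℝ v) (h2 : Integrable fun x => ‖v x‖ ^ 2)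
    (hg : Integrable (gradSq v)) : MemH1 v := by
  refine ⟨hd, ?_, ?_⟩
  · exact (memLp_two_iff_integrable_sq_norm hd.continuous.aestronglyMeasurable).2 h2
  · have hm : AEStronglyMeasurable (fun x => fderiv ℝ v x) (volume : Measure E2) :=
      (measurable_fderiv ℝ v).aestronglyMeasurable
    refine (memLp_two_iff_integrable_sq_norm hm).2 ?_
    refine (hg.const_mul 2).mono' (hm.norm.pow 2) (Eventually.of_forall fun x => ?_)
    rw [Real.norm_of_nonneg (by positivity)]
    exact opNorm_sq_le _

lemma scalar_ge (ε : ℝ) (μ : E2 → ℝ) (f v : E2 → E2) (hv : IsMinimizer ε 0 μ f v)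
    (s : E2 → ℝ) (hs : Differentiable ℝ s) (h2 : Integrable fun x => s x ^ 2)
    (hg : Integrable (sgrad s)) : ∫ x, vden ε μ v x ≤ ∫ x, sden ε μ s x := by
  have h := hv.2 (fun x => s x • e2basis 0) (memH1_of _ (hs.smul_const _) ?_ ?_)
  · rw [energy_zero, energy_zero] at h
    simpa only [scalar_vden ε μ s hs] using h
  · simpa [norm_smul, norm_e2basis] using h2
  · have : gradSq (fun x => s x • e2basis 0) = sgrad s := funext (scalar_gradSq s hs)
    rw [this]
    exact hg

/-- A minimizer with all the pieces of its energy density integrable. -/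
structure GoodMin (ε : ℝ) (μ : E2 → ℝ) (f v : E2 → E2) : Prop where
  ismin : IsMinimizer ε 0 μ f v
  diff : Differentiable ℝ v
  ig : Integrable (gradSq v)
  i2 : Integrable fun x => ‖v x‖ ^ 2
  i4 : Integrable fun x => ‖v x‖ ^ 4

lemma mu_mul_integrable (μ : E2 → ℝ) (hμc : Continuous μ) (C : ℝ) (hC : ∀ x, |μ x| ≤ C)
    (F : E2 → ℝ) (hF : Integrable F) : Integrable fun x => μ x * F x := by
  refine (hF.norm.const_mul C).mono' (hμc.aestronglyMeasurable.mul hF.1)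
    (Eventually.of_forall fun x => ?_)
  rw [norm_mul]
  exact mul_le_mul_of_nonneg_right (hC x) (norm_nonneg _)

lemma goodMin_of (ε : ℝ) (hε : 0 < ε) (μ : E2 → ℝ) (f v : E2 → E2) (hμc : Continuous μ) (C : ℝ)
    (hC : ∀ x, |μ x| ≤ C) (hv : IsMinimizer ε 0 μ f v) (hneg : ∫ x, vden ε μ v x < 0) :
    GoodMin ε μ f v := by
  have hi : Integrable (vden ε μ v) := by
    by_contra hcon
    rw [integral_undef hcon] at hneg
    exact lt_irrefl _ hneg
  have i2 : Integrable fun x => ‖v x‖ ^ 2 :=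
    (memLp_two_iff_integrable_sq_norm hv.1.2.1.1).1 hv.1.2.1
  have ig := gradSq_integrable v hv.1
  refine ⟨hv, hv.1.1, ig, i2, ?_⟩
  have i5 := ((hi.sub (ig.const_mul (1/2))).add
    ((mu_mul_integrable μ hμc C hC _ i2).const_mul (1/(2*ε^2)))).const_mul (4*ε^2)
  refine i5.congr (Eventually.of_forall fun x => ?_)
  simp only [Pi.add_apply, Pi.sub_apply, vden]
  field_simp
  ring

lemma GoodMin.vden_integrable {ε : ℝ} {μ : E2 → ℝ} {f v : E2 → E2} (hv : GoodMin ε μ f v)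
    (hμc : Continuous μ) (C : ℝ) (hC : ∀ x, |μ x| ≤ C) : Integrable (vden ε μ v) := by
  have := ((hv.ig.const_mul (1/2)).sub
    ((mu_mul_integrable μ hμc C hC _ hv.i2).const_mul (1/(2*ε^2)))).add
      (hv.i4.const_mul (1/(4*ε^2)))
  refine this.congr (Eventually.of_forall fun x => ?_)
  simp only [Pi.add_apply, Pi.sub_apply, vden]
  ring

/-- negative energy -/
lemma exists_neg (μ : E2 → ℝ) (μrad : ℝ → ℝ) (ρ : ℝ) (hμ : MuHyp μ μrad ρ) :
    ∃ ε₀ : ℝ, 0 < ε₀ ∧ ∀ ε : ℝ, 0 < ε → ε < ε₀ → ∀ (f v : E2 → E2), IsMinimizer ε 0 μ f v →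
      ∫ x, vden ε μ v x < 0 := by
  have hanti : StrictAntiOn μrad (Ici 0) := by
    apply strictAntiOn_of_deriv_neg (convex_Ici 0) hμ.smooth_rad.continuous.continuousOn
    intro r hr
    rw [interior_Ici] at hr
    exact hμ.deriv_neg r hr
  set c := μrad (ρ/2) with hc
  have hρ := hμ.rho_pos
  have hcp : 0 < c := by
    rw [hc, ← hμ.rho_root]
    exact hanti (by simp; linarith) (by simp; linarith) (by linarith)
  have hball : ∀ x : E2, ‖x‖ ≤ ρ/2 → c ≤ μ x := by
    intro x hx
    rw [hμ.radial]
    exact hanti.antitoneOn (norm_nonneg x) (by simp; linarith) hx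
  have hμc : Continuous μ := hμ.smooth.continuous
  obtain ⟨C, hC⟩ := hμ.bdd
  let b : ContDiffBump (0:E2) := ⟨ρ/4, ρ/2, by linarith, by linarith⟩
  set s : E2 → ℝ := fun x => √c * b x with hs
  have hsC : ContDiff ℝ 1 s := contDiff_const.mul b.contDiff
  have hsd : Differentiable ℝ s := hsC.differentiable one_ne_zero
  have hscs : HasCompactSupport s := b.hasCompactSupport.mul_left
  have hsc : Continuous s := hsC.continuous
  have hs2c : HasCompactSupport fun x => s x ^ 2 := hscs.comp_left (g := fun t : ℝ => t ^ 2) (by simp)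
  have hs4c : HasCompactSupport fun x => s x ^ 4 := hscs.comp_left (g := fun t : ℝ => t ^ 4) (by simp)
  have i2 : Integrable fun x => s x ^ 2 := (hsc.pow 2).integrable_of_hasCompactSupport hs2c
  have i4 : Integrable fun x => s x ^ 4 := (hsc.pow 4).integrable_of_hasCompactSupport hs4c
  have ig : Integrable (sgrad s) := by
    apply integrable_finsetSum
    intro i _
    apply Continuous.integrable_of_hasCompactSupport
    · exact ((hsC.continuous_fderiv one_ne_zero).clm_apply continuous_const).pow 2
    · exact (hscs.fderiv (𝕜 := ℝ)).comp_left (g := fun L : E2 →L[ℝ] ℝ => (L (e2basis i)) ^ 2) (by simp)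
  have iμ := mu_mul_integrable μ hμc C hC _ i2
  have hsle : ∀ x, s x ^ 2 ≤ c := by
    intro x
    simp only [hs, mul_pow, Real.sq_sqrt hcp.le]
    have h0 := b.nonneg (x := x)
    have h1 := b.le_one (x := x)
    have : (b x) ^ 2 ≤ 1 := pow_le_one₀ h0 h1
    nlinarith
  have hlow : ∀ x, c / 2 * s x ^ 2 ≤ μ x * s x ^ 2 - (1/2) * s x ^ 4 := by
    intro x
    by_cases hx : ‖x‖ ≤ ρ/2
    · have h1 := hball x hx
      have h2 := hsle x
      have h3 := sq_nonneg (s x)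
      nlinarith [mul_nonneg h3 (sub_nonneg.2 h1), mul_nonneg h3 (sub_nonneg.2 h2)]
    · have : s x = 0 := by
        simp only [hs]
        rw [b.zero_of_le_dist, mul_zero]
        push Not at hx
        simpa [b] using hx.le
      simp [this]
  set g := ∫ x, sgrad s x with hg
  set N := ∫ x, c / 2 * s x ^ 2 with hN
  have hg0 : 0 ≤ g := integral_nonneg fun x => Finset.sum_nonneg fun i _ => sq_nonneg _
  have hNp : 0 < N := by
    rw [hN, integral_const_mul]
    apply mul_pos (by linarith)
    rw [integral_pos_iff_support_of_nonneg (fun x => sq_nonneg _) i2]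
    have hop : IsOpen (Function.support fun x => s x ^ 2) := (hsc.pow 2).isOpen_support
    refine hop.measure_pos volume ⟨0, ?_⟩
    have : b (0:E2) = 1 := b.one_of_mem_closedBall (by simp [b]; linarith)
    simp [hs, this, hcp.not_ge, Real.sqrt_eq_zero']
  refine ⟨√(N / (g + 1)), Real.sqrt_pos.2 (by positivity), ?_⟩
  intro ε hε hlt f v hv
  refine (scalar_ge ε μ f v hv s hsd i2 ig).trans_lt ?_
  have hε2 : ε ^ 2 < N / (g + 1) := by
    rw [Real.lt_sqrt hε.le] at hlt
    exact hlt
  have e1 : ∫ x, sden ε μ s x = (1/2) * g - (1/(2*ε^2)) * ∫ x, (μ x * s x ^ 2 - (1/2) * s x ^ 4) := by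
    have i6 : Integrable fun x => (1/(2*ε^2)) * (μ x * s x ^ 2 - (1/2) * s x ^ 4) :=
      (iμ.sub (i4.const_mul (1/2))).const_mul _
    rw [hg, ← integral_const_mul, ← integral_const_mul, ← integral_sub (ig.const_mul _) i6]
    congr 1
    ext x
    simp only [sden]
    field_simp
    ring
  have e2 : N ≤ ∫ x, (μ x * s x ^ 2 - (1/2) * s x ^ 4) :=
    integral_mono (i2.const_mul _) (iμ.sub (i4.const_mul _)) hlow
  rw [e1]
  have h3 : g < N / ε ^ 2 := by
    rw [lt_div_iff₀ (by positivity)]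
    rw [lt_div_iff₀ (by positivity)] at hε2
    nlinarith [sq_nonneg ε]
  have h4 : (1/(2*ε^2)) * N ≤ (1/(2*ε^2)) * ∫ x, (μ x * s x ^ 2 - (1/2) * s x ^ 4) :=
    mul_le_mul_of_nonneg_left e2 (by positivity)
  have h5 : (1/(2*ε^2)) * N = (1/2) * (N / ε^2) := by field_simp
  linarith

/-- A positive auxiliary function in `H¹`. -/
def psi (x : E2) : ℝ := (1 + ‖x‖ ^ 2)⁻¹

lemma psi_pos (x : E2) : 0 < psi x := by unfold psi; positivity

lemma psi_le_one (x : E2) : psi x ≤ 1 := by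
  unfold psi
  apply inv_le_one_of_one_le₀
  nlinarith [sq_nonneg ‖x‖]

lemma psi_hasFDerivAt (x : E2) :
    HasFDerivAt psi (-((1 + ‖x‖ ^ 2) ^ 2)⁻¹ • (2 • (innerSL ℝ x))) x := by
  have h1 : HasFDerivAt (fun x : E2 => 1 + ‖x‖ ^ 2) (2 • (innerSL ℝ x)) x :=
    ((hasStrictFDerivAt_norm_sq x).hasFDerivAt).const_add 1
  have h2 : HasDerivAt (fun t : ℝ => t⁻¹) (-((1 + ‖x‖ ^ 2) ^ 2)⁻¹) (1 + ‖x‖ ^ 2) :=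
    hasDerivAt_inv (by positivity)
  exact h2.comp_hasFDerivAt x h1

lemma psi_diff : Differentiable ℝ psi := fun x => (psi_hasFDerivAt x).differentiableAt

lemma psi_grad (x : E2) (i : Fin 2) : (fderiv ℝ psi x (e2basis i)) ^ 2 ≤ psi x ^ 2 := by
  rw [(psi_hasFDerivAt x).fderiv]
  have h0 : |(inner ℝ x (e2basis i) : ℝ)| ≤ ‖x‖ := by
    have := abs_real_inner_le_norm x (e2basis i)
    rwa [norm_e2basis, mul_one] at this
  apply sq_le_sq.2
  rw [abs_of_pos (psi_pos x)]
  simp only [smul_apply, innerSL_apply_apply, smul_eq_mul, nsmul_eq_mul,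
    Nat.cast_ofNat, abs_mul, abs_neg, abs_inv]
  have hp : (0:ℝ) < 1 + ‖x‖ ^ 2 := by positivity
  rw [abs_of_pos (by positivity : (0:ℝ) < (1 + ‖x‖ ^ 2) ^ 2), abs_two]
  unfold psi
  have h2 : 2 * |(inner ℝ x (e2basis i) : ℝ)| ≤ 1 + ‖x‖ ^ 2 := by
    nlinarith [sq_nonneg (‖x‖ - 1)]
  calc ((1 + ‖x‖ ^ 2) ^ 2)⁻¹ * (2 * |(inner ℝ x (e2basis i) : ℝ)|)
      ≤ ((1 + ‖x‖ ^ 2) ^ 2)⁻¹ * (1 + ‖x‖ ^ 2) := by gcongr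
    _ = (1 + ‖x‖ ^ 2)⁻¹ := by field_simp

lemma psi_sq_integrable : Integrable fun x => psi x ^ 2 := by
  have h := integrable_rpow_neg_one_add_norm_sq (E := E2) (μ := volume) (r := 4) (by norm_num)
  refine h.congr (Eventually.of_forall fun x => ?_)
  simp only [psi]
  rw [show (-4/2 : ℝ) = -(2:ℕ) by norm_num, Real.rpow_neg (by positivity), Real.rpow_natCast, inv_pow]

/-- radicand of the competitor -/
def Pcomp (v w : E2 → E2) (δ : ℝ) (x : E2) : ℝ :=
  (‖v x‖ ^ 2 + ‖w x‖ ^ 2) / 2 + δ ^ 2 * psi x ^ 2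

/-- the competitor -/
def Ucomp (v w : E2 → E2) (δ : ℝ) (x : E2) : ℝ := √(Pcomp v w δ x)

section comp
variable {v w : E2 → E2} {δ : ℝ}

lemma Pcomp_pos (hδ : 0 < δ) (x : E2) : 0 < Pcomp v w δ x := by
  have := psi_pos x
  unfold Pcomp
  positivity

lemma Ucomp_pos (hδ : 0 < δ) (x : E2) : 0 < Ucomp v w δ x := Real.sqrt_pos.2 (Pcomp_pos hδ x)

lemma Ucomp_sq (hδ : 0 < δ) (x : E2) : Ucomp v w δ x ^ 2 = Pcomp v w δ x :=
  Real.sq_sqrt (Pcomp_pos hδ x).le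

lemma Pcomp_hasFDerivAt (hv : Differentiable ℝ v) (hw : Differentiable ℝ w) (x : E2) :
    ∃ L : E2 →L[ℝ] ℝ, HasFDerivAt (Pcomp v w δ) L x ∧ ∀ y, L y =
      inner ℝ (v x) (fderiv ℝ v x y) + inner ℝ (w x) (fderiv ℝ w x y)
        + δ ^ 2 * (2 * psi x * fderiv ℝ psi x y) := by
  have h1 := (hv x).hasFDerivAt.norm_sq
  have h2 := (hw x).hasFDerivAt.norm_sq
  have h3 := (psi_diff x).hasFDerivAt.pow 2
  have h4 := ((h1.add h2).const_mul (1/2)).add (h3.const_mul (δ ^ 2))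
  refine ⟨_, h4.congr_of_eventuallyEq (Eventually.of_forall fun y => ?_), fun y => ?_⟩
  · simp only [Pcomp, Pi.add_apply]; ring
  · simp

lemma Ucomp_hasFDerivAt (hδ : 0 < δ) (hv : Differentiable ℝ v) (hw : Differentiable ℝ w) (x : E2) :
    ∃ L : E2 →L[ℝ] ℝ, HasFDerivAt (Ucomp v w δ) L x ∧ ∀ y, 2 * Ucomp v w δ x * L y =
      inner ℝ (v x) (fderiv ℝ v x y) + inner ℝ (w x) (fderiv ℝ w x y)
        + δ ^ 2 * (2 * psi x * fderiv ℝ psi x y) := by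
  obtain ⟨L, hL, hLy⟩ := Pcomp_hasFDerivAt (δ := δ) hv hw x
  refine ⟨_, hL.sqrt (Pcomp_pos hδ x).ne', fun y => ?_⟩
  rw [← hLy y]
  have := Ucomp_pos (v := v) (w := w) hδ x
  simp only [smul_apply, smul_eq_mul]
  unfold Ucomp at *
  field_simp

lemma Ucomp_diff (hδ : 0 < δ) (hv : Differentiable ℝ v) (hw : Differentiable ℝ w) :
    Differentiable ℝ (Ucomp v w δ) := fun x =>
  (Ucomp_hasFDerivAt hδ hv hw x).choose_spec.1.differentiableAt

lemma Ucomp_grad (hδ : 0 < δ) (hv : Differentiable ℝ v) (hw : Differentiable ℝ w) (x : E2)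
    (i : Fin 2) :
    (fderiv ℝ (Ucomp v w δ) x (e2basis i)) ^ 2 ≤
      (1/2) * ‖fderiv ℝ v x (e2basis i)‖ ^ 2 + (1/2) * ‖fderiv ℝ w x (e2basis i)‖ ^ 2
        + δ ^ 2 * psi x ^ 2 := by
  obtain ⟨L, hL, hLy⟩ := Ucomp_hasFDerivAt hδ hv hw x
  rw [hL.fderiv]
  have h1 := hLy (e2basis i)
  have hU := Ucomp_pos (v := v) (w := w) hδ x
  have hU2 := Ucomp_sq (v := v) (w := w) hδ x
  have hψ := psi_grad x i
  set l := L (e2basis i)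
  set dv := fderiv ℝ v x (e2basis i)
  set dw := fderiv ℝ w x (e2basis i)
  set dp := fderiv ℝ psi x (e2basis i)
  have c1 := abs_le.1 (abs_real_inner_le_norm (v x) dv)
  have c2 := abs_le.1 (abs_real_inner_le_norm (w x) dw)
  set a : ℝ := inner ℝ (v x) dv
  set b : ℝ := inner ℝ (w x) dw
  set U := Ucomp v w δ x
  set p := psi x
  -- Cauchy-Schwarz
  have key : U ^ 2 * l ^ 2 ≤ U ^ 2 * ((1/2) * ‖dv‖ ^ 2 + (1/2) * ‖dw‖ ^ 2 + δ ^ 2 * dp ^ 2) := by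
    have e1 : U ^ 2 * l ^ 2 = ((1/2) * a + (1/2) * b + δ ^ 2 * (p * dp)) ^ 2 := by
      have : U * l = (1/2) * a + (1/2) * b + δ ^ 2 * (p * dp) := by linarith
      rw [← this]; ring
    have e2 : |(1/2) * a + (1/2) * b + δ ^ 2 * (p * dp)| ≤
        (1/2) * (‖v x‖ * ‖dv‖) + (1/2) * (‖w x‖ * ‖dw‖) + δ ^ 2 * (p * |dp|) := by
      have hp : 0 < p := psi_pos x
      have h3 : |dp| ≥ dp := le_abs_self _
      have h4 : -|dp| ≤ dp := neg_abs_le _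
      have h5 : p * dp ≤ p * |dp| := by gcongr
      have h6 : -(p * |dp|) ≤ p * dp := by nlinarith
      have h7 : 0 ≤ δ ^ 2 := sq_nonneg _
      rw [abs_le]
      constructor <;> nlinarith
    rw [e1, ← sq_abs]
    refine (pow_le_pow_left₀ (abs_nonneg _) e2 2).trans ?_
    rw [hU2]
    unfold Pcomp
    have hdp : dp ^ 2 = |dp| ^ 2 := (sq_abs _).symm
    rw [hdp]
    set A := ‖v x‖
    set B := ‖w x‖
    set q := |dp|
    change _ ≤ ((A ^ 2 + B ^ 2) / 2 + δ ^ 2 * p ^ 2) * _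
    nlinarith [sq_nonneg (A * ‖dw‖ - B * ‖dv‖), sq_nonneg (δ * (A * q - p * ‖dv‖)),
      sq_nonneg (δ * (B * q - p * ‖dw‖))]
  have := le_of_mul_le_mul_left key (by positivity)
  nlinarith [mul_nonneg (sq_nonneg δ) (sub_nonneg.2 hψ)]

lemma Ucomp_sgrad (hδ : 0 < δ) (hv : Differentiable ℝ v) (hw : Differentiable ℝ w) (x : E2) :
    sgrad (Ucomp v w δ) x ≤ (1/2) * gradSq v x + (1/2) * gradSq w x + 2 * δ ^ 2 * psi x ^ 2 := by
  have h0 := Ucomp_grad hδ hv hw x 0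
  have h1 := Ucomp_grad hδ hv hw x 1
  unfold sgrad gradSq
  simp only [Fin.sum_univ_two]
  linarith

end comp

lemma sgrad_nonneg (s : E2 → ℝ) (x : E2) : 0 ≤ sgrad s x := Finset.sum_nonneg fun _ _ => sq_nonneg _

lemma sden_integrable (ε : ℝ) (μ : E2 → ℝ) (hμc : Continuous μ) (C : ℝ) (hC : ∀ x, |μ x| ≤ C)
    (s : E2 → ℝ) (h2 : Integrable fun x => s x ^ 2) (h4 : Integrable fun x => s x ^ 4)
    (hg : Integrable (sgrad s)) : Integrable (sden ε μ s) := by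
  have := ((hg.const_mul (1/2)).sub
    ((mu_mul_integrable μ hμc C hC _ h2).const_mul (1/(2*ε^2)))).add
      (h4.const_mul (1/(4*ε^2)))
  refine this.congr (Eventually.of_forall fun x => ?_)
  simp only [Pi.add_apply, Pi.sub_apply, sden]
  ring

/-- error function -/
def cerr (ε C : ℝ) (v w : E2 → E2) (x : E2) : ℝ :=
  psi x ^ 2 * (1 + C/(2*ε^2) + 1/(4*ε^2)) + (1/(4*ε^2)) * (‖v x‖ ^ 2 + ‖w x‖ ^ 2)

lemma integral_lin4 {f₁ f₂ f₃ f₄ : E2 → ℝ} (h₁ : Integrable f₁) (h₂ : Integrable f₂)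
    (h₃ : Integrable f₃) (h₄ : Integrable f₄) (a b c d : ℝ) :
    ∫ x, (a * f₁ x + b * f₂ x + c * f₃ x + d * f₄ x) =
      a * (∫ x, f₁ x) + b * (∫ x, f₂ x) + c * (∫ x, f₃ x) + d * ∫ x, f₄ x := by
  have i12 : Integrable fun x => a * f₁ x + b * f₂ x := (h₁.const_mul a).add (h₂.const_mul b)
  have i123 : Integrable fun x => a * f₁ x + b * f₂ x + c * f₃ x := i12.add (h₃.const_mul c)
  rw [integral_add i123 (h₄.const_mul d), integral_add i12 (h₃.const_mul c),
    integral_add (h₁.const_mul a) (h₂.const_mul b)]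
  simp only [integral_const_mul]

section two
variable {ε : ℝ} {μ : E2 → ℝ} {f v w : E2 → E2} {δ C : ℝ}

lemma cerr_integrable (hv : GoodMin ε μ f v) (hw : GoodMin ε μ f w) :
    Integrable (cerr ε C v w) :=
  (psi_sq_integrable.mul_const _).add ((hv.i2.add hw.i2).const_mul _)

lemma Ucomp_i2 (hδ : 0 < δ) (hv : GoodMin ε μ f v) (hw : GoodMin ε μ f w) :
    Integrable fun x => Ucomp v w δ x ^ 2 := by
  have : (fun x => Ucomp v w δ x ^ 2) = Pcomp v w δ := funext fun x => Ucomp_sq hδ x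
  rw [this]
  exact ((hv.i2.add hw.i2).div_const 2).add (psi_sq_integrable.const_mul _)

lemma Ucomp_ig (hδ : 0 < δ) (hv : GoodMin ε μ f v) (hw : GoodMin ε μ f w) :
    Integrable (sgrad (Ucomp v w δ)) := by
  refine (((hv.ig.const_mul (1/2)).add (hw.ig.const_mul (1/2))).add
    (psi_sq_integrable.const_mul (2 * δ ^ 2))).mono' (measurable_sgrad _).aestronglyMeasurable
    (Eventually.of_forall fun x => ?_)
  rw [Real.norm_of_nonneg (sgrad_nonneg _ _)]
  simpa using Ucomp_sgrad hδ hv.diff hw.diff x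

lemma Ucomp_i4 (hδ : 0 < δ) (hδ1 : δ ≤ 1) (hv : GoodMin ε μ f v) (hw : GoodMin ε μ f w) :
    Integrable fun x => Ucomp v w δ x ^ 4 := by
  refine ((hv.i4.add hw.i4).add (psi_sq_integrable.const_mul 2)).mono'
    ((Ucomp_diff hδ hv.diff hw.diff).continuous.pow 4).aestronglyMeasurable
    (Eventually.of_forall fun x => ?_)
  rw [Real.norm_of_nonneg (by positivity)]
  simp only [Pi.add_apply]
  have h4 : Ucomp v w δ x ^ 4 = Pcomp v w δ x ^ 2 := by rw [← Ucomp_sq hδ]; ring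
  rw [h4]
  unfold Pcomp
  have hp := psi_pos x
  have hp1 := psi_le_one x
  have hq : (δ ^ 2 * psi x ^ 2) ^ 2 ≤ psi x ^ 2 := by
    have h5 : δ ^ 2 ≤ 1 := pow_le_one₀ hδ.le hδ1
    have h6 : psi x ^ 2 ≤ 1 := pow_le_one₀ hp.le hp1
    have h7 : δ ^ 2 * psi x ^ 2 ≤ psi x ^ 2 := by nlinarith [sq_nonneg (psi x)]
    have h8 : 0 ≤ δ ^ 2 * psi x ^ 2 := by positivity
    nlinarith
  nlinarith [sq_nonneg (‖v x‖ ^ 2 - ‖w x‖ ^ 2), sq_nonneg ((‖v x‖ ^ 2 + ‖w x‖ ^ 2) / 2 - δ ^ 2 * psi x ^ 2)]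

lemma Ucomp_sden (hε : 0 < ε) (hδ : 0 < δ) (hδ1 : δ ≤ 1) (hC : ∀ x, |μ x| ≤ C)
    (hv : GoodMin ε μ f v) (hw : GoodMin ε μ f w) (x : E2) :
    sden ε μ (Ucomp v w δ) x ≤ (1/2) * vden ε μ v x + (1/2) * vden ε μ w x
      - (1/(16*ε^2)) * (‖v x‖ ^ 2 - ‖w x‖ ^ 2) ^ 2 + δ ^ 2 * cerr ε C v w x := by
  have hg := Ucomp_sgrad hδ hv.diff hw.diff x
  have hp := psi_pos x
  have hp1 := psi_le_one x
  have hμ := abs_le.1 (hC x)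
  have h4 : Ucomp v w δ x ^ 4 = Pcomp v w δ x ^ 2 := by rw [← Ucomp_sq hδ]; ring
  unfold sden vden cerr
  rw [h4, Ucomp_sq hδ]
  unfold Pcomp
  set A := ‖v x‖
  set B := ‖w x‖
  set p := psi x
  obtain ⟨k, hk⟩ : ∃ k, k = 1/(4*ε^2) := ⟨_, rfl⟩
  have hk0 : 0 < k := by rw [hk]; positivity
  have k2 : 1/(2*ε^2) = 2*k := by rw [hk]; field_simp; norm_num
  have k16 : 1/(16*ε^2) = k/4 := by rw [hk]; field_simp; norm_num
  have kC : C/(2*ε^2) = 2*k*C := by rw [← k2]; ring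
  rw [k2, k16, kC, ← hk]
  have h5 : δ ^ 2 ≤ 1 := pow_le_one₀ hδ.le hδ1
  have h6 : p ^ 2 ≤ 1 := pow_le_one₀ hp.le hp1
  have h6' : 0 ≤ p ^ 2 := sq_nonneg _
  have h5' : 0 ≤ δ ^ 2 := sq_nonneg _
  have e1 : -(μ x) * (δ ^ 2 * p ^ 2) ≤ C * (δ ^ 2 * p ^ 2) := by
    have : 0 ≤ δ ^ 2 * p ^ 2 := by positivity
    nlinarith
  have e2 : (δ ^ 2 * p ^ 2) ^ 2 ≤ δ ^ 2 * p ^ 2 := by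
    have : δ ^ 2 * p ^ 2 ≤ 1 := by nlinarith
    have h8 : 0 ≤ δ ^ 2 * p ^ 2 := by positivity
    nlinarith
  have e3 : δ ^ 2 * p ^ 2 * (A ^ 2 + B ^ 2) ≤ δ ^ 2 * (A ^ 2 + B ^ 2) := by
    have : 0 ≤ δ ^ 2 * (A ^ 2 + B ^ 2) := by positivity
    nlinarith
  have e4 : ((A ^ 2 + B ^ 2) / 2 + δ ^ 2 * p ^ 2) ^ 2 ≤ (A ^ 4 + B ^ 4) / 2 - (A ^ 2 - B ^ 2) ^ 2 / 4
      + δ ^ 2 * (A ^ 2 + B ^ 2) + δ ^ 2 * p ^ 2 := by nlinarith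
  have e5 := mul_le_mul_of_nonneg_left e4 hk0.le
  have e6 := mul_le_mul_of_nonneg_left e1 (by positivity : 0 ≤ 2 * k)
  nlinarith

lemma min_eq (hv : GoodMin ε μ f v) (hw : GoodMin ε μ f w) :
    ∫ x, vden ε μ w x = ∫ x, vden ε μ v x := by
  have h1 := hv.ismin.2 w hw.ismin.1
  have h2 := hw.ismin.2 v hv.ismin.1
  rw [energy_zero, energy_zero] at h1 h2
  exact le_antisymm h2 h1

lemma norm_eq_of_min (hε : 0 < ε) (hμc : Continuous μ) (hC : ∀ x, |μ x| ≤ C)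
    (hv : GoodMin ε μ f v) (hw : GoodMin ε μ f w) (x : E2) : ‖v x‖ = ‖w x‖ := by
  set Q : E2 → ℝ := fun x => (‖v x‖ ^ 2 - ‖w x‖ ^ 2) ^ 2 with hQ
  have hQc : Continuous Q :=
    ((hv.diff.continuous.norm.pow 2).sub (hw.diff.continuous.norm.pow 2)).pow 2
  have hQi : Integrable Q := by
    refine (((hv.i4.const_mul 2).add (hw.i4.const_mul 2))).mono' hQc.aestronglyMeasurable
      (Eventually.of_forall fun x => ?_)
    rw [Real.norm_of_nonneg (sq_nonneg _)]
    simp only [Pi.add_apply]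
    nlinarith [sq_nonneg (‖v x‖ ^ 2 + ‖w x‖ ^ 2)]
  have iv := hv.vden_integrable hμc C hC
  have iw := hw.vden_integrable hμc C hC
  have ic := cerr_integrable (C := C) hv hw
  have main : ∀ δ : ℝ, 0 < δ → δ ≤ 1 →
      (1/(16*ε^2)) * ∫ x, Q x ≤ δ ^ 2 * ∫ x, cerr ε C v w x := by
    intro δ hδ hδ1
    have hge := scalar_ge ε μ f v hv.ismin _ (Ucomp_diff hδ hv.diff hw.diff) (Ucomp_i2 hδ hv hw)
      (Ucomp_ig hδ hv hw)
    have hi := sden_integrable ε μ hμc C hC _ (Ucomp_i2 hδ hv hw) (Ucomp_i4 hδ hδ1 hv hw)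
      (Ucomp_ig hδ hv hw)
    have hub : Integrable fun x => (1/2) * vden ε μ v x + (1/2) * vden ε μ w x
      - (1/(16*ε^2)) * Q x + δ ^ 2 * cerr ε C v w x :=
      (((iv.const_mul _).add (iw.const_mul _)).sub (hQi.const_mul _)).add (ic.const_mul _)
    have hle := integral_mono hi hub (fun x => Ucomp_sden hε hδ hδ1 hC hv hw x)
    have e : ∫ x, ((1/2) * vden ε μ v x + (1/2) * vden ε μ w x
      - (1/(16*ε^2)) * Q x + δ ^ 2 * cerr ε C v w x) =
      (1/2) * (∫ x, vden ε μ v x) + (1/2) * (∫ x, vden ε μ w x)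
        - (1/(16*ε^2)) * (∫ x, Q x) + δ ^ 2 * ∫ x, cerr ε C v w x := by
      have := integral_lin4 iv iw hQi ic (1/2) (1/2) (-(1/(16*ε^2))) (δ ^ 2)
      simpa only [neg_mul, ← sub_eq_add_neg] using this
    rw [e, min_eq hv hw] at hle
    linarith
  have hzero : ∫ x, Q x ≤ 0 := by
    have hlim : Tendsto (fun δ : ℝ => δ ^ 2 * ∫ x, cerr ε C v w x) (𝓝[>] 0) (𝓝 0) := by
      have : Tendsto (fun δ : ℝ => δ ^ 2 * ∫ x, cerr ε C v w x) (𝓝 0)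
          (𝓝 ((0:ℝ) ^ 2 * ∫ x, cerr ε C v w x)) :=
        ((continuous_id.pow 2).mul continuous_const).tendsto 0
      simpa using this.mono_left nhdsWithin_le_nhds
    have h1 : (1/(16*ε^2)) * ∫ x, Q x ≤ 0 := by
      apply ge_of_tendsto hlim
      filter_upwards [Ioc_mem_nhdsGT (zero_lt_one' ℝ)] with δ hδ
      exact main δ hδ.1 hδ.2
    have h2 : 0 < 1/(16*ε^2) := by positivity
    by_contra hcon
    push Not at hcon
    linarith [mul_pos h2 hcon]
  have hQ0 : Q =ᵐ[volume] 0 := by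
    rw [← integral_eq_zero_iff_of_nonneg (fun x => sq_nonneg _) hQi]
    exact le_antisymm hzero (integral_nonneg fun x => sq_nonneg _)
  have hQ1 : Q = 0 := Continuous.ae_eq_iff_eq volume hQc continuous_const |>.1 hQ0
  have h3 : Q x = 0 := congrFun hQ1 x
  have h4 : ‖v x‖ ^ 2 = ‖w x‖ ^ 2 := by
    have := pow_eq_zero_iff (two_ne_zero) |>.1 h3
    linarith
  exact (pow_left_inj₀ (norm_nonneg _) (norm_nonneg _) two_ne_zero).1 h4

end two

lemma sum_sq_basis (L : E2 →L[ℝ] E2) (b : OrthonormalBasis (Fin 2) ℝ E2) :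
    ∑ i, ‖L (b i)‖ ^ 2 = ∑ j, ‖L.adjoint (EuclideanSpace.basisFun (Fin 2) ℝ j)‖ ^ 2 := by
  set c := EuclideanSpace.basisFun (Fin 2) ℝ
  calc ∑ i, ‖L (b i)‖ ^ 2 = ∑ i, ∑ j, ‖(inner ℝ (c j) (L (b i)) : ℝ)‖ ^ 2 := by
        simp only [OrthonormalBasis.sum_sq_norm_inner_right]
    _ = ∑ j, ∑ i, ‖(inner ℝ (L.adjoint (c j)) (b i) : ℝ)‖ ^ 2 := by
        rw [Finset.sum_comm]
        simp only [ContinuousLinearMap.adjoint_inner_left]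
    _ = _ := by simp only [OrthonormalBasis.sum_sq_norm_inner_left]

lemma gradSq_rot (v : E2 → E2) (hv : Differentiable ℝ v) (R : E2 ≃ₗᵢ[ℝ] E2) (x : E2) :
    gradSq (fun x => v (R x)) x = gradSq v (R x) := by
  have hd : ∀ y, fderiv ℝ (fun x => v (R x)) x y = fderiv ℝ v (R x) (R y) := by
    intro y
    have h1 : HasFDerivAt (fun x => R x) (R.toContinuousLinearEquiv : E2 →L[ℝ] E2) x :=
      R.toContinuousLinearEquiv.hasFDerivAt
    have := (hv (R x)).hasFDerivAt.comp x h1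
    have h2 : fderiv ℝ (fun x => v (R x)) x = _ := this.fderiv
    rw [h2]
    rfl
  unfold gradSq
  simp only [hd]
  have h1 := sum_sq_basis (fderiv ℝ v (R x)) (EuclideanSpace.basisFun (Fin 2) ℝ)
  have h2 := sum_sq_basis (fderiv ℝ v (R x)) ((EuclideanSpace.basisFun (Fin 2) ℝ).map R)
  rw [← h1] at h2
  simpa [e2basis] using h2

lemma isMin_rot (ε : ℝ) (μ : E2 → ℝ) (f v : E2 → E2) (R : E2 ≃ₗᵢ[ℝ] E2)
    (hμ : ∀ x, μ (R x) = μ x) (hv : IsMinimizer ε 0 μ f v) :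
    IsMinimizer ε 0 μ f (fun x => v (R x)) := by
  have hmp : MeasurePreserving R := R.measurePreserving
  have hg : gradSq (fun x => v (R x)) = fun x => gradSq v (R x) :=
    funext (gradSq_rot v hv.1.1 R)
  have i2 : Integrable fun x => ‖v x‖ ^ 2 :=
    (memLp_two_iff_integrable_sq_norm hv.1.2.1.1).1 hv.1.2.1
  refine ⟨memH1_of _ ?_ ?_ ?_, ?_⟩
  · exact hv.1.1.comp R.toContinuousLinearEquiv.differentiable
  · exact hmp.integrable_comp_of_integrable i2
  · rw [hg]
    exact hmp.integrable_comp_of_integrable (gradSq_integrable v hv.1)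
  · intro u hu
    have : energy ε 0 μ f (fun x => v (R x)) = energy ε 0 μ f v := by
      rw [energy_zero, energy_zero]
      have h1 : (fun x => vden ε μ (fun x => v (R x)) x) = fun x => vden ε μ v (R x) := by
        ext x
        simp only [vden, hg, hμ]
      rw [h1]
      exact hmp.integral_comp R.toHomeomorph.measurableEmbedding (vden ε μ v)
    rw [this]
    exact hv.2 u hu

/-- first variation density -/
def ell (ε : ℝ) (μ : E2 → ℝ) (v : E2 → E2) (φ : E2 → ℝ) (δ : ℝ) (x : E2) : ℝ :=
  (∑ i : Fin 2, fderiv ℝ (Ucomp v v δ) x (e2basis i) * fderiv ℝ φ x (e2basis i))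
    + (1/ε^2) * ((Ucomp v v δ x ^ 2 - μ x) * Ucomp v v δ x * φ x)

lemma sgrad_integrable_of_compact (s : E2 → ℝ) (hsC : ContDiff ℝ 1 s) (hscs : HasCompactSupport s) :
    Integrable (sgrad s) := by
  apply integrable_finsetSum
  intro i _
  apply Continuous.integrable_of_hasCompactSupport
  · exact ((hsC.continuous_fderiv one_ne_zero).clm_apply continuous_const).pow 2
  · exact (hscs.fderiv (𝕜 := ℝ)).comp_left (g := fun L : E2 →L[ℝ] ℝ => (L (e2basis i)) ^ 2) (by simp)

section pert
variable {ε : ℝ} {μ : E2 → ℝ} {f v : E2 → E2} {C : ℝ} {φ : E2 → ℝ}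

lemma grad_part_integrable (δ : ℝ) (hδ : 0 < δ) (hv : GoodMin ε μ f v)
    (hφ : ContDiff ℝ 1 φ) (hφc : HasCompactSupport φ) :
    Integrable fun x => ∑ i : Fin 2,
      fderiv ℝ (Ucomp v v δ) x (e2basis i) * fderiv ℝ φ x (e2basis i) := by
  refine ((Ucomp_ig hδ hv hv).add (sgrad_integrable_of_compact φ hφ hφc)).mono' ?_
    (Eventually.of_forall fun x => ?_)
  · exact (Finset.measurable_sum _ fun i _ => (measurable_fderiv_apply_const ℝ _ (e2basis i)).mul
      (measurable_fderiv_apply_const ℝ _ (e2basis i))).aestronglyMeasurable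
  · simp only [Pi.add_apply, sgrad, Fin.sum_univ_two, Real.norm_eq_abs]
    set a := fderiv ℝ (Ucomp v v δ) x (e2basis 0)
    set b := fderiv ℝ (Ucomp v v δ) x (e2basis 1)
    set c := fderiv ℝ φ x (e2basis 0)
    set d := fderiv ℝ φ x (e2basis 1)
    rw [abs_le]
    constructor <;> nlinarith [sq_nonneg (a + c), sq_nonneg (a - c), sq_nonneg (b + d),
      sq_nonneg (b - d), sq_nonneg a, sq_nonneg b, sq_nonneg c, sq_nonneg d]

lemma pot_part_integrable (δ : ℝ) (hδ : 0 < δ) (hμc : Continuous μ) (hv : GoodMin ε μ f v)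
    (hφ : ContDiff ℝ 1 φ) (hφc : HasCompactSupport φ) :
    Integrable fun x => (1/ε^2) * ((Ucomp v v δ x ^ 2 - μ x) * Ucomp v v δ x * φ x) := by
  have hUc := (Ucomp_diff hδ hv.diff hv.diff).continuous
  have hφ' := hφ.continuous
  exact ((((((hUc.pow 2).sub hμc).mul hUc).mul hφ')).integrable_of_hasCompactSupport
    hφc.mul_left).const_mul _

set_option maxHeartbeats 1000000 in
lemma perturb (hε : 0 < ε) (hμc : Continuous μ) (hC : ∀ x, |μ x| ≤ C)
    (hv : GoodMin ε μ f v) (hφ : ContDiff ℝ 1 φ) (hφc : HasCompactSupport φ) :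
    ∃ K₁ K₂ : ℝ, ∀ δ : ℝ, 0 < δ → δ ≤ 1 → ∀ t : ℝ, |t| ≤ 1 →
      0 ≤ δ ^ 2 * K₁ + t * (∫ x, ell ε μ v φ δ x) + t ^ 2 * K₂ := by
  set k : E2 → ℝ := fun x => (1/2) * sgrad φ x + (C/(2*ε^2)) * φ x ^ 2
    + (1/(4*ε^2)) * (8 * (‖v x‖ ^ 2 + 1) * φ x ^ 2 + 3 * φ x ^ 4) with hk
  have hφ' := hφ.continuous
  have hφd : Differentiable ℝ φ := hφ.differentiable one_ne_zero
  have hφ2c : HasCompactSupport fun x => φ x ^ 2 :=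
    hφc.comp_left (g := fun t : ℝ => t ^ 2) (by simp)
  have hφ4c : HasCompactSupport fun x => φ x ^ 4 :=
    hφc.comp_left (g := fun t : ℝ => t ^ 4) (by simp)
  have iφ2 : Integrable fun x => φ x ^ 2 := (hφ'.pow 2).integrable_of_hasCompactSupport hφ2c
  have iφ4 : Integrable fun x => φ x ^ 4 := (hφ'.pow 4).integrable_of_hasCompactSupport hφ4c
  have iφg := sgrad_integrable_of_compact φ hφ hφc
  have hvc : Continuous v := hv.diff.continuous
  have ik : Integrable k := by
    refine ((iφg.const_mul _).add (iφ2.const_mul _)).add (Integrable.const_mul ?_ _)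
    refine Integrable.add ?_ (iφ4.const_mul 3)
    exact Continuous.integrable_of_hasCompactSupport (by fun_prop) hφ2c.mul_left
  refine ⟨∫ x, cerr ε C v v x, ∫ x, k x, fun δ hδ hδ1 t ht => ?_⟩
  have hU := Ucomp_diff hδ hv.diff hv.diff
  have hUc := hU.continuous
  set U := Ucomp v v δ with hUdef
  set s : E2 → ℝ := fun x => U x + t * φ x with hs
  have hsd : Differentiable ℝ s := hU.add (hφd.const_mul t)
  have hsf : ∀ x y, fderiv ℝ s x y = fderiv ℝ U x y + t * fderiv ℝ φ x y := by
    intro x y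
    have := ((hU x).hasFDerivAt.add ((hφd x).hasFDerivAt.const_mul t)).fderiv
    have h2 : fderiv ℝ s x = _ := this
    rw [h2]
    simp
  have ht2 : t ^ 2 ≤ 1 := by rw [← sq_abs]; exact pow_le_one₀ (abs_nonneg _) ht
  have hsg : ∀ x, sgrad s x ≤ 2 * sgrad U x + 2 * sgrad φ x := by
    intro x
    simp only [sgrad, Fin.sum_univ_two, hsf]
    set a := fderiv ℝ U x (e2basis 0)
    set b := fderiv ℝ U x (e2basis 1)
    set c := fderiv ℝ φ x (e2basis 0)
    set d := fderiv ℝ φ x (e2basis 1)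
    nlinarith [sq_nonneg (a - t * c), sq_nonneg (b - t * d), mul_nonneg (sub_nonneg.2 ht2) (sq_nonneg c),
      mul_nonneg (sub_nonneg.2 ht2) (sq_nonneg d)]
  have isg : Integrable (sgrad s) := by
    refine (((Ucomp_ig hδ hv hv).const_mul 2).add (iφg.const_mul 2)).mono'
      (measurable_sgrad _).aestronglyMeasurable (Eventually.of_forall fun x => ?_)
    rw [Real.norm_of_nonneg (sgrad_nonneg _ _)]
    exact hsg x
  have hsq : ∀ x, s x ^ 2 ≤ 2 * U x ^ 2 + 2 * φ x ^ 2 := by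
    intro x
    simp only [hs]
    nlinarith [sq_nonneg (U x - t * φ x), mul_nonneg (sub_nonneg.2 ht2) (sq_nonneg (φ x))]
  have is2 : Integrable fun x => s x ^ 2 := by
    refine (((Ucomp_i2 hδ hv hv).const_mul 2).add (iφ2.const_mul 2)).mono'
      (hsd.continuous.pow 2).aestronglyMeasurable (Eventually.of_forall fun x => ?_)
    rw [Real.norm_of_nonneg (sq_nonneg _)]
    exact hsq x
  have is4 : Integrable fun x => s x ^ 4 := by
    refine (((Ucomp_i4 hδ hδ1 hv hv).const_mul 8).add (iφ4.const_mul 8)).mono'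
      (hsd.continuous.pow 4).aestronglyMeasurable (Eventually.of_forall fun x => ?_)
    rw [Real.norm_of_nonneg (by positivity)]
    have h1 := hsq x
    simp only [Pi.add_apply]
    change s x ^ 4 ≤ 8 * U x ^ 4 + 8 * φ x ^ 4
    calc s x ^ 4 = (s x ^ 2) ^ 2 := by ring
      _ ≤ (2 * U x ^ 2 + 2 * φ x ^ 2) ^ 2 := by gcongr
      _ ≤ _ := by nlinarith [sq_nonneg (U x ^ 2 - φ x ^ 2)]
  have hge := scalar_ge ε μ f v hv.ismin s hsd is2 isg
  have isd := sden_integrable ε μ hμc C hC s is2 is4 isg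
  have iell : Integrable (ell ε μ v φ δ) :=
    (grad_part_integrable δ hδ hv hφ hφc).add (pot_part_integrable δ hδ hμc hv hφ hφc)
  have iv := hv.vden_integrable hμc C hC
  have ic := cerr_integrable (C := C) hv hv
  have hpt : ∀ x, sden ε μ s x ≤ 1 * vden ε μ v x + δ ^ 2 * cerr ε C v v x + t * ell ε μ v φ δ x
      + t ^ 2 * k x := by
    intro x
    have h1 := Ucomp_sden hε hδ hδ1 hC hv hv x
    have hμx := abs_le.1 (hC x)
    have hUsq : U x ^ 2 ≤ ‖v x‖ ^ 2 + 1 := by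
      rw [hUdef, Ucomp_sq hδ, Pcomp]
      have h5 : δ ^ 2 ≤ 1 := pow_le_one₀ hδ.le hδ1
      have h6 : psi x ^ 2 ≤ 1 := pow_le_one₀ (psi_pos x).le (psi_le_one x)
      have : δ ^ 2 * psi x ^ 2 ≤ 1 := by nlinarith [sq_nonneg δ, sq_nonneg (psi x)]
      linarith
    have hsg' : sgrad s x = sgrad U x + 2 * t * (∑ i : Fin 2,
        fderiv ℝ U x (e2basis i) * fderiv ℝ φ x (e2basis i)) + t ^ 2 * sgrad φ x := by
      simp only [sgrad, Fin.sum_univ_two, hsf]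
      ring
    have h2 : sden ε μ s x = sden ε μ U x + t * ell ε μ v φ δ x + t ^ 2 * ((1/2) * sgrad φ x
        - (1/(2*ε^2)) * μ x * φ x ^ 2 + (1/(4*ε^2)) * (6 * U x ^ 2 * φ x ^ 2 + 4 * t * U x * φ x ^ 3
          + t ^ 2 * φ x ^ 4)) := by
      have hsx : s x = U x + t * φ x := rfl
      unfold sden
      rw [hsg', hsx]
      simp only [ell, ← hUdef]
      field_simp
      ring
    have h3 : (1/2) * sgrad φ x
        - (1/(2*ε^2)) * μ x * φ x ^ 2 + (1/(4*ε^2)) * (6 * U x ^ 2 * φ x ^ 2 + 4 * t * U x * φ x ^ 3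
          + t ^ 2 * φ x ^ 4) ≤ k x := by
      simp only [hk]
      have h4 : -((1/(2*ε^2)) * μ x * φ x ^ 2) ≤ (C/(2*ε^2)) * φ x ^ 2 := by
        have : (C/(2*ε^2)) * φ x ^ 2 + (1/(2*ε^2)) * μ x * φ x ^ 2
          = (1/(2*ε^2)) * ((C + μ x) * φ x ^ 2) := by ring
        have h5 : 0 ≤ (1/(2*ε^2)) * ((C + μ x) * φ x ^ 2) := by
          have : 0 ≤ C + μ x := by linarith
          positivity
        linarith
      have h6 : 6 * U x ^ 2 * φ x ^ 2 + 4 * t * U x * φ x ^ 3 + t ^ 2 * φ x ^ 4 ≤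
          8 * (‖v x‖ ^ 2 + 1) * φ x ^ 2 + 3 * φ x ^ 4 := by
        have h7 : 4 * t * U x * φ x ^ 3 ≤ 2 * U x ^ 2 * φ x ^ 2 + 2 * (t ^ 2 * φ x ^ 4) := by
          nlinarith [sq_nonneg (U x * φ x - t * φ x ^ 2)]
        have h8 : t ^ 2 * φ x ^ 4 ≤ φ x ^ 4 := by
          have : 0 ≤ φ x ^ 4 := by positivity
          nlinarith
        nlinarith [mul_le_mul_of_nonneg_right hUsq (sq_nonneg (φ x))]
      have h9 := mul_le_mul_of_nonneg_left h6 (by positivity : 0 ≤ 1/(4*ε^2))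
      linarith
    have h10 := mul_le_mul_of_nonneg_left h3 (sq_nonneg t)
    rw [← hUdef] at h1
    have h0 : (‖v x‖ ^ 2 - ‖v x‖ ^ 2) ^ 2 = 0 := by simp
    rw [h0] at h1
    rw [h2]
    linarith
  have iub : Integrable fun x => 1 * vden ε μ v x + δ ^ 2 * cerr ε C v v x + t * ell ε μ v φ δ x
      + t ^ 2 * k x :=
    (((iv.const_mul _).add (ic.const_mul _)).add (iell.const_mul _)).add (ik.const_mul _)
  have hle := integral_mono isd iub hpt
  rw [integral_lin4 iv ic iell ik] at hle
  linarith

end pert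

/-- derivative of a radial function away from the origin -/
lemma radial_hasFDerivAt (g : ℝ → ℝ) (g' : ℝ) (x : E2) (hx : x ≠ 0) (hg : HasDerivAt g g' ‖x‖) :
    HasFDerivAt (fun y : E2 => g ‖y‖) ((g' / ‖x‖) • innerSL ℝ x) x := by
  have hn : ‖x‖ ≠ 0 := norm_ne_zero_iff.2 hx
  have h1 : HasFDerivAt (fun y : E2 => ‖y‖ ^ 2) (2 • innerSL ℝ x) x := by
    simpa using (hasFDerivAt_id x).norm_sq
  have h2 := h1.sqrt (by positivity)
  have h3 : (fun y : E2 => √(‖y‖ ^ 2)) = fun y => ‖y‖ := by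
    ext y; exact Real.sqrt_sq (norm_nonneg _)
  rw [h3] at h2
  have h4 := hg.comp_hasFDerivAt x h2
  have h5 : (g' / ‖x‖) • innerSL ℝ x = g' • (1 / (2 * √(‖x‖ ^ 2))) • 2 • innerSL ℝ x := by
    rw [Real.sqrt_sq (norm_nonneg _)]
    ext y
    simp
    field_simp
  rw [h5]
  exact h4

lemma radial_pair (g k : ℝ → ℝ) (g' k' : ℝ) (x : E2) (hx : x ≠ 0) (hg : HasDerivAt g g' ‖x‖)
    (hk : HasDerivAt k k' ‖x‖) :
    ∑ i : Fin 2, fderiv ℝ (fun y : E2 => g ‖y‖) x (e2basis i)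
      * fderiv ℝ (fun y : E2 => k ‖y‖) x (e2basis i) = g' * k' := by
  have hn : ‖x‖ ≠ 0 := norm_ne_zero_iff.2 hx
  rw [(radial_hasFDerivAt g g' x hx hg).fderiv, (radial_hasFDerivAt k k' x hx hk).fderiv]
  have h5 : ‖x‖ ^ 2 = x 0 ^ 2 + x 1 ^ 2 := by
    rw [EuclideanSpace.norm_sq_eq]; simp [Fin.sum_univ_two]
  have h6 : ∀ i, inner ℝ x (e2basis i) = x i := by
    intro i
    simp [e2basis, EuclideanSpace.inner_single_right]
  simp only [Fin.sum_univ_two, smul_apply, innerSL_apply_apply, smul_eq_mul, h6]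
  have : g' / ‖x‖ * x 0 * (k' / ‖x‖ * x 0) + g' / ‖x‖ * x 1 * (k' / ‖x‖ * x 1)
      = g' * k' * (x 0 ^ 2 + x 1 ^ 2) / ‖x‖ ^ 2 := by field_simp
  rw [this, ← h5]
  field_simp

/-- radial test function facts -/
lemma testfun (χ : ℝ → ℝ) (a R : ℝ) (hχ : Continuous χ) (ha : 0 < a) (haR : a < R)
    (hsupp : ∀ r, r ∉ Icc a R → χ r = 0) (hmean : ∫ r in (0:ℝ)..R, χ r = 0) :
    ∃ X κ Φ : ℝ → ℝ, X = (fun s => ∫ t in (0:ℝ)..s, χ t) ∧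
      Φ = (fun r => ∫ s in R..r, (∫ t in (0:ℝ)..s, χ t) / s) ∧
      (∀ s, HasDerivAt X (χ s) s) ∧ (∀ s, HasDerivAt Φ (κ s) s) ∧ (∀ s, s * κ s = X s) ∧
      X 0 = 0 ∧ (∀ s, R ≤ s → X s = 0) ∧ (∀ s, R ≤ s → Φ s = 0) ∧
      ContDiff ℝ 1 (fun x : E2 => Φ ‖x‖) ∧ HasCompactSupport (fun x : E2 => Φ ‖x‖) := by
  set X : ℝ → ℝ := fun s => ∫ t in (0:ℝ)..s, χ t with hX
  have hXd : ∀ s, HasDerivAt X (χ s) s := fun s =>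
    intervalIntegral.integral_hasDerivAt_right (hχ.intervalIntegrable _ _)
      (hχ.stronglyMeasurableAtFilter _ _) hχ.continuousAt
  have hXc : Continuous X := continuous_iff_continuousAt.2 fun s => (hXd s).continuousAt
  have hXz : ∀ s, s < a → X s = 0 := by
    intro s hs
    apply intervalIntegral.integral_zero_ae
    refine Eventually.of_forall fun t ht => hsupp t fun h => ?_
    have := ht.2
    have : t < a := lt_of_le_of_lt this (max_lt ha hs)
    linarith [h.1]
  have hX0 : X 0 = 0 := hXz 0 ha
  have hXR : ∀ s, R ≤ s → X s = 0 := by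
    intro s hs
    have h1 : X s = (∫ t in (0:ℝ)..R, χ t) + ∫ t in R..s, χ t :=
      (intervalIntegral.integral_add_adjacent_intervals (hχ.intervalIntegrable _ _)
        (hχ.intervalIntegrable _ _)).symm
    rw [h1, hmean, zero_add]
    apply intervalIntegral.integral_zero_ae
    refine Eventually.of_forall fun t ht => hsupp t fun h => ?_
    rw [uIoc_of_le hs] at ht
    linarith [h.2, ht.1]
  set κ : ℝ → ℝ := fun s => X s / s with hκ
  have hκc : Continuous κ := by
    rw [continuous_iff_continuousAt]
    intro s
    by_cases hs : s = 0
    · have : κ =ᶠ[𝓝 s] fun _ => 0 := by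
        filter_upwards [Iio_mem_nhds (show s < a by rw [hs]; exact ha)] with y hy
        simp [hκ, hXz y hy]
      exact continuousAt_const.congr this.symm
    · exact hXc.continuousAt.div continuousAt_id hs
  set Φ : ℝ → ℝ := fun r => ∫ s in R..r, κ s with hΦ
  have hΦd : ∀ s, HasDerivAt Φ (κ s) s := fun s =>
    intervalIntegral.integral_hasDerivAt_right (hκc.intervalIntegrable _ _)
      (hκc.stronglyMeasurableAtFilter _ _) hκc.continuousAt
  have hΦR : ∀ s, R ≤ s → Φ s = 0 := by
    intro s hs
    apply intervalIntegral.integral_zero_ae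
    refine Eventually.of_forall fun t ht => ?_
    rw [uIoc_of_le hs] at ht
    simp [hκ, hXR t ht.1.le]
  have hΦ1 : ContDiff ℝ 1 Φ := by
    rw [contDiff_one_iff_deriv]
    refine ⟨fun s => (hΦd s).differentiableAt, ?_⟩
    have : deriv Φ = κ := funext fun s => (hΦd s).deriv
    rw [this]; exact hκc
  have hΦ0 : ∀ s, 0 ≤ s → s < a → Φ s = Φ 0 := by
    intro s hs hsa
    have h1 : Φ 0 + ∫ t in (0:ℝ)..s, κ t = Φ s :=
      intervalIntegral.integral_add_adjacent_intervals (hκc.intervalIntegrable _ _)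
        (hκc.intervalIntegrable _ _)
    have h2 : ∫ t in (0:ℝ)..s, κ t = 0 := by
      apply intervalIntegral.integral_zero_ae
      refine Eventually.of_forall fun t ht => ?_
      rw [uIoc_of_le hs] at ht
      simp [hκ, hXz t (lt_of_le_of_lt ht.2 hsa)]
    rw [← h1, h2, add_zero]
  refine ⟨X, κ, Φ, rfl, rfl, hXd, hΦd, ?_, hX0, hXR, hΦR, ?_, ?_⟩
  · intro s
    by_cases hs : s = 0
    · simp [hs, hX0]
    · simp only [hκ]; field_simp
  · rw [contDiff_iff_contDiffAt]
    intro x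
    by_cases hx : x = 0
    · have : (fun x : E2 => Φ ‖x‖) =ᶠ[𝓝 x] fun _ => Φ 0 := by
        filter_upwards [Metric.ball_mem_nhds x ha] with y hy
        rw [hx, mem_ball_zero_iff] at hy
        exact hΦ0 _ (norm_nonneg _) hy
      exact contDiffAt_const.congr_of_eventuallyEq this
    · exact hΦ1.contDiffAt.comp x (contDiffAt_norm ℝ hx)
  · refine HasCompactSupport.intro (isCompact_closedBall (0:E2) R) fun x hx => ?_
    rw [mem_closedBall_zero_iff, not_le] at hx
    exact hΦR _ hx.le

/-- radial profile of the regularised modulus -/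
def uprof (h : ℝ → ℝ) (δ r : ℝ) : ℝ := √(h r ^ 2 + δ ^ 2 * ((1 + r ^ 2)⁻¹) ^ 2)

lemma Ioi_eq_interval (F : ℝ → ℝ) (R : ℝ) (hR : 0 ≤ R) (hF : ∀ r, R ≤ r → F r = 0) :
    ∫ r in Ioi (0:ℝ), F r = ∫ r in (0:ℝ)..R, F r := by
  rw [intervalIntegral.integral_of_le hR]
  refine setIntegral_eq_of_subset_of_forall_sdiff_eq_zero measurableSet_Ioi (fun x hx => hx.1) ?_
  intro x hx
  refine hF x ?_
  by_contra hcon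
  exact hx.2 ⟨hx.1, (not_le.1 hcon).le⟩

lemma ell_radial {ε : ℝ} {μ : E2 → ℝ} {f v : E2 → E2} {μrad h χ X κ Φ : ℝ → ℝ} {R : ℝ}
    (hR : 0 < R) (hχ : Continuous χ) (hχR : ∀ s, R ≤ s → χ s = 0 ∨ s = R)
    (hXd : ∀ s, HasDerivAt X (χ s) s) (hΦd : ∀ s, HasDerivAt Φ (κ s) s) (hκ : ∀ s, s * κ s = X s)
    (hX0 : X 0 = 0) (hXR : ∀ s, R ≤ s → X s = 0) (hΦR : ∀ s, R ≤ s → Φ s = 0)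
    (hφ : ContDiff ℝ 1 (fun x : E2 => Φ ‖x‖)) (hφc : HasCompactSupport (fun x : E2 => Φ ‖x‖))
    (hμc : Continuous μ) (hμr : ∀ x, μ x = μrad ‖x‖) (hv : GoodMin ε μ f v)
    (hh : ∀ r, h r = ‖v (r • e2basis 0)‖) (hvr : ∀ x, ‖v x‖ = h ‖x‖) (δ : ℝ) (hδ : 0 < δ) :
    ∫ x, ell ε μ v (fun x : E2 => Φ ‖x‖) δ x = (2 * volume.real (Metric.ball (0:E2) 1)) *
      ∫ r in (0:ℝ)..R, (-(uprof h δ r * χ r) +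
        r * ((1/ε^2) * ((uprof h δ r ^ 2 - μrad r) * uprof h δ r)) * Φ r) := by
  set φ : E2 → ℝ := fun x : E2 => Φ ‖x‖ with hφdef
  set u := uprof h δ with hu
  have hU := Ucomp_diff hδ hv.diff hv.diff
  have hUu : Ucomp v v δ = fun x => u ‖x‖ := by
    ext x
    simp only [Ucomp, Pcomp, hu, uprof, hvr, psi]
    congr 1
    ring
  have huU : u = fun r => Ucomp v v δ (r • e2basis 0) := by
    ext r
    simp only [Ucomp, Pcomp, hu, uprof, hh, psi, norm_smul, norm_e2basis, mul_one, Real.norm_eq_abs,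
      sq_abs]
    congr 1
    ring
  have hud : Differentiable ℝ u := by
    rw [huU]
    exact hU.comp (differentiable_id.smul_const _)
  have hud' : ∀ r, HasDerivAt u (deriv u r) r := fun r => (hud r).hasDerivAt
  have huc := hud.continuous
  set P : ℝ → ℝ := fun r => (1/ε^2) * ((u r ^ 2 - μrad r) * u r * Φ r) with hP
  have hne : ∀ᵐ x : E2, x ≠ 0 := by
    rw [ae_iff]; simp
  have hgrad : (fun x => ∑ i : Fin 2, fderiv ℝ (Ucomp v v δ) x (e2basis i) * fderiv ℝ φ x (e2basis i))
      =ᵐ[volume] fun x => (fun r => deriv u r * κ r) ‖x‖ := by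
    filter_upwards [hne] with x hx
    rw [hUu]
    exact radial_pair u Φ _ _ x hx (hud' _) (hΦd _)
  have hpot : (fun x => (1/ε^2) * ((Ucomp v v δ x ^ 2 - μ x) * Ucomp v v δ x * φ x))
      = fun x => P ‖x‖ := by
    ext x
    simp only [hUu, hμr, hP, hφdef]
  have ig := (grad_part_integrable δ hδ hv hφ hφc)
  have ip := (pot_part_integrable δ hδ hμc hv hφ hφc)
  have e0 : ∫ x, ell ε μ v φ δ x = (∫ x, ∑ i : Fin 2,
      fderiv ℝ (Ucomp v v δ) x (e2basis i) * fderiv ℝ φ x (e2basis i))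
      + ∫ x, (1/ε^2) * ((Ucomp v v δ x ^ 2 - μ x) * Ucomp v v δ x * φ x) := integral_add ig ip
  have ig' := ig.congr hgrad
  rw [hpot] at ip
  replace ig' := (integrable_fun_norm_addHaar volume (f := fun r => deriv u r * κ r)).1 ig'
  replace ip := (integrable_fun_norm_addHaar volume (f := P)).1 ip
  rw [e0, integral_congr_ae hgrad, hpot,
    integral_fun_norm_addHaar volume (fun r => deriv u r * κ r), integral_fun_norm_addHaar volume P]
  simp only [finrank_euclideanSpace, Fintype.card_fin, Nat.add_one_sub_one, pow_one, smul_eq_mul,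
    nsmul_eq_mul] at ig' ip ⊢
  have e1 : (fun y => y * (deriv u y * κ y)) = fun y => deriv u y * X y := by
    ext y; rw [← hκ]; ring
  rw [e1] at ig' ⊢
  have hXc : Continuous X := continuous_iff_continuousAt.2 fun s => (hXd s).continuousAt
  have hχz : ∀ s, R < s → χ s = 0 := fun s hs => (hχR s hs.le).resolve_right hs.ne'
  have huχ0 : ∫ y in Ioi (0:ℝ), u y * χ y = ∫ y in (0:ℝ)..R, u y * χ y := by
    rw [intervalIntegral.integral_of_le hR.le]
    refine setIntegral_eq_of_subset_of_forall_sdiff_eq_zero measurableSet_Ioi (fun x hx => hx.1) ?_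
    intro x hx
    rw [hχz x, mul_zero]
    by_contra hcon
    exact hx.2 ⟨hx.1, (not_lt.1 hcon)⟩
  have iuχ : IntegrableOn (fun y => u y * χ y) (Ioi 0) := by
    have h1 : IntegrableOn (fun y => u y * χ y) (Icc 0 R) :=
      (huc.mul hχ).continuousOn.integrableOn_compact isCompact_Icc
    refine h1.of_forall_sdiff_eq_zero measurableSet_Ioi fun x hx => ?_
    rw [hχz x, mul_zero]
    by_contra hcon
    exact hx.2 ⟨le_of_lt hx.1, (not_lt.1 hcon)⟩
  have eibp : ∫ y in Ioi (0:ℝ), (deriv u y * X y + u y * χ y) = 0 - u 0 * X 0 := by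
    refine integral_Ioi_of_hasDerivAt_of_tendsto' (f := fun y => u y * X y)
      (fun x _ => (hud' x).mul (hXd x)) (ig'.add iuχ) ?_
    refine tendsto_const_nhds.congr' ?_
    filter_upwards [eventually_ge_atTop R] with y hy
    simp [hXR y hy]
  rw [integral_add ig' iuχ, hX0, huχ0] at eibp
  have e2 : ∫ y in Ioi (0:ℝ), y * P y = ∫ y in (0:ℝ)..R, y * P y :=
    Ioi_eq_interval _ R hR.le fun r hr => by simp [hP, hΦR r hr]
  rw [e2]
  have iP : IntervalIntegrable (fun y => y * P y) volume 0 R := by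
    rw [intervalIntegrable_iff_integrableOn_Ioc_of_le hR.le]
    exact ip.mono_set fun x hx => hx.1
  have e3 : ∫ r in (0:ℝ)..R, (-(u r * χ r) + r * ((1/ε^2) * ((u r ^ 2 - μrad r) * u r)) * Φ r)
      = -(∫ r in (0:ℝ)..R, u r * χ r) + ∫ r in (0:ℝ)..R, r * P r := by
    rw [← intervalIntegral.integral_neg, ← intervalIntegral.integral_add]
    · congr 1; ext r; simp only [hP]; ring
    · exact (Continuous.neg (huc.mul hχ)).intervalIntegrable _ _
    · exact iP
  rw [e3]
  have e4 : ∫ y in Ioi (0:ℝ), deriv u y * X y = -∫ r in (0:ℝ)..R, u r * χ r := by linarith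
  rw [e4]
  push_cast
  ring

lemma weak_radial {ε : ℝ} {μ : E2 → ℝ} {f v : E2 → E2} {μrad h : ℝ → ℝ} {C : ℝ} (hε : 0 < ε)
    (hC : ∀ x, |μ x| ≤ C) (hμc : Continuous μ) (hμrc : Continuous μrad)
    (hμr : ∀ x, μ x = μrad ‖x‖) (hv : GoodMin ε μ f v)
    (hh : ∀ r, h r = ‖v (r • e2basis 0)‖) (hvr : ∀ x, ‖v x‖ = h ‖x‖)
    (χ : ℝ → ℝ) (a R : ℝ) (hχ : Continuous χ) (ha : 0 < a) (haR : a < R)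
    (hsupp : ∀ r, r ∉ Icc a R → χ r = 0) (hmean : ∫ r in (0:ℝ)..R, χ r = 0) :
    ∫ r in (0:ℝ)..R, (-(h r * χ r) + r * ((1/ε^2) * (h r ^ 2 - μrad r) * h r) *
      (∫ s in R..r, (∫ t in (0:ℝ)..s, χ t) / s)) = 0 := by
  obtain ⟨X, κ, Φ, hX, hΦ, hXd, hΦd, hκ, hX0, hXR, hΦR, hφ, hφc⟩ :=
    testfun χ a R hχ ha haR hsupp hmean
  have hR : 0 < R := ha.trans haR
  have hΦc : Continuous Φ := continuous_iff_continuousAt.2 fun s => (hΦd s).continuousAt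
  have hhc : Continuous h := by
    have : h = fun r : ℝ => ‖v (r • e2basis 0)‖ := funext hh
    rw [this]
    exact (hv.diff.continuous.comp (continuous_id.smul continuous_const)).norm
  obtain ⟨K₁, K₂, hK⟩ := perturb hε hμc hC hv hφ hφc
  set M : ℝ → ℝ := fun δ => ∫ r in (0:ℝ)..R, (-(uprof h δ r * χ r) +
        r * ((1/ε^2) * ((uprof h δ r ^ 2 - μrad r) * uprof h δ r)) * Φ r) with hM
  have hMc : Continuous M := by
    apply intervalIntegral.continuous_parametric_intervalIntegral_of_continuous'
    have hup : Continuous fun p : ℝ × ℝ => uprof h p.1 p.2 := by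
      unfold uprof
      have h1 : Continuous fun p : ℝ × ℝ => (1 + p.2 ^ 2)⁻¹ :=
        Continuous.inv₀ (by fun_prop) fun p => by positivity
      fun_prop
    unfold Function.uncurry
    fun_prop
  have hM0 : M 0 = ∫ r in (0:ℝ)..R, (-(h r * χ r) + r * ((1/ε^2) * (h r ^ 2 - μrad r) * h r) *
      (∫ s in R..r, (∫ t in (0:ℝ)..s, χ t) / s)) := by
    simp only [hM]
    congr 1
    ext r
    have h0 : uprof h 0 r = h r := by
      have : 0 ≤ h r := by rw [hh]; positivity
      simp [uprof, Real.sqrt_sq this]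
    rw [h0, hΦ]
    ring
  rw [← hM0]
  set c := 2 * volume.real (Metric.ball (0:E2) 1) with hc
  have hcpos : 0 < c := by
    have h1 : 0 < volume.real (Metric.ball (0:E2) 1) := by
      refine ENNReal.toReal_pos (Metric.measure_ball_pos _ _ one_pos).ne' measure_ball_lt_top.ne
    positivity
  have hδ : ∀ δ, 0 < δ → δ ≤ 1 → ∀ t : ℝ, |t| ≤ 1 →
      0 ≤ δ ^ 2 * K₁ + t * (c * M δ) + t ^ 2 * K₂ := by
    intro δ hδ hδ1 t ht
    have h1 := hK δ hδ hδ1 t ht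
    rwa [ell_radial hR hχ (fun s hs => ?_) hXd hΦd hκ hX0 hXR hΦR hφ hφc hμc hμr hv hh hvr δ hδ] at h1
    by_cases hsR : s = R
    · exact Or.inr hsR
    · left
      exact hsupp s fun h => hsR (le_antisymm h.2 hs)
  have h0 : ∀ t : ℝ, |t| ≤ 1 → 0 ≤ t * (c * M 0) + t ^ 2 * K₂ := by
    intro t ht
    have hcont : Continuous fun δ : ℝ => δ ^ 2 * K₁ + t * (c * M δ) + t ^ 2 * K₂ := by fun_prop
    have h1 : Tendsto (fun δ : ℝ => δ ^ 2 * K₁ + t * (c * M δ) + t ^ 2 * K₂) (𝓝[>] 0)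
        (𝓝 ((0:ℝ) ^ 2 * K₁ + t * (c * M 0) + t ^ 2 * K₂)) :=
      (hcont.tendsto 0).mono_left nhdsWithin_le_nhds
    have h2 : 0 ≤ (0:ℝ) ^ 2 * K₁ + t * (c * M 0) + t ^ 2 * K₂ := by
      refine ge_of_tendsto h1 ?_
      filter_upwards [Ioc_mem_nhdsGT (zero_lt_one' ℝ)] with δ hd
      exact hδ δ hd.1 hd.2 t ht
    simpa using h2
  by_contra hne
  have hne' : c * M 0 ≠ 0 := mul_ne_zero hcpos.ne' hne
  set m := c * M 0 with hm
  set K := |K₂| + |m| + 1 with hKd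
  have hKp : 0 < K := by positivity
  have h1 := h0 (-(m / K)) (by
    rw [abs_neg, abs_div, abs_of_pos hKp, div_le_one hKp]
    linarith [abs_nonneg K₂])
  have h2 : -(m / K) * m + (-(m / K)) ^ 2 * K₂ = (m ^ 2 / K ^ 2) * (K₂ - K) := by
    field_simp
    ring
  rw [h2] at h1
  have h3 : K₂ - K < 0 := by linarith [le_abs_self K₂, abs_nonneg m]
  have h4 : 0 < m ^ 2 / K ^ 2 := by positivity
  nlinarith [mul_pos h4 (neg_pos.2 h3)]

/-- everywhere differentiable map with a.e. zero derivative is constant -/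
lemma const_of_ae_fderiv_zero (n : E2 → E2) (hn : Differentiable ℝ n)
    (h : ∀ᵐ x, fderiv ℝ n x = 0) (x z : E2) : n x = n z := by
  have key : ∀ y : E2, (fun x => n (x + y)) = n := by
    intro y
    have hm : Measurable fun p : ℝ × E2 => fderiv ℝ n (p.2 + p.1 • y) :=
      (measurable_fderiv ℝ n).comp (by fun_prop)
    have hms : MeasurableSet {p : ℝ × E2 | fderiv ℝ n (p.2 + p.1 • y) = 0} :=
      hm (measurableSet_singleton 0)
    have h1 : ∀ᵐ t : ℝ, ∀ᵐ x : E2, fderiv ℝ n (x + t • y) = 0 := by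
      refine Eventually.of_forall fun t => ?_
      exact (measurePreserving_add_right volume (t • y)).quasiMeasurePreserving.ae h
    have h2 : ∀ᵐ x : E2, ∀ᵐ t : ℝ, fderiv ℝ n (x + t • y) = 0 :=
      (Measure.ae_ae_comm hms).1 h1
    have h3 : (fun x => n (x + y)) =ᵐ[volume] n := by
      filter_upwards [h2] with x hx
      have hd : ∀ t : ℝ, HasDerivAt (fun t : ℝ => n (x + t • y)) (fderiv ℝ n (x + t • y) y) t := by
        intro t
        have h4 : HasDerivAt (fun t : ℝ => x + t • y) y t := by
          simpa using ((hasDerivAt_id t).smul_const y).const_add x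
        exact (hn _).hasFDerivAt.comp_hasDerivAt t h4
      have h0 : (fun t : ℝ => fderiv ℝ n (x + t • y) y) =ᵐ[volume] fun _ => (0 : E2) := by
        filter_upwards [hx] with t ht
        rw [ht]; rfl
      have hi : IntervalIntegrable (fun t : ℝ => fderiv ℝ n (x + t • y) y) volume 0 1 := by
        rw [intervalIntegrable_iff]
        exact (integrable_congr (ae_restrict_of_ae h0)).2 (integrable_zero _ _ _)
      have h5 := intervalIntegral.integral_eq_sub_of_hasDerivAt (a := 0) (b := 1)
        (fun t _ => hd t) hi
      rw [intervalIntegral.integral_zero_ae] at h5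
      · simp only [one_smul, zero_smul, add_zero] at h5
        exact (sub_eq_zero.1 h5.symm)
      · filter_upwards [h0] with t ht _ using ht
    exact (Continuous.ae_eq_iff_eq volume
      (hn.continuous.comp (continuous_id.add continuous_const)) hn.continuous).1 h3
  have := congrFun (key (z - x)) x
  simp only [add_sub_cancel] at this
  exact this.symm

lemma dir_const {ε : ℝ} {μ : E2 → ℝ} {f v : E2 → E2} {C : ℝ}
    (hC : ∀ x, |μ x| ≤ C) (hμc : Continuous μ) (hv : GoodMin ε μ f v) (hv0 : ∀ x, v x ≠ 0) :
    ∃ e : E2, ‖e‖ = 1 ∧ ∀ x, v x = ‖v x‖ • e := by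
  set s : E2 → ℝ := fun x => ‖v x‖ with hs
  have hs0 : ∀ x, s x ≠ 0 := fun x => norm_ne_zero_iff.2 (hv0 x)
  have hsd : Differentiable ℝ s := fun x => (hv.diff x).norm ℝ (hv0 x)
  set n : E2 → E2 := fun x => (s x)⁻¹ • v x with hn
  have hnd : Differentiable ℝ n := (hsd.inv hs0).smul hv.diff
  have hvn : v = fun x => s x • n x := by
    ext1 x
    simp only [hn]
    rw [smul_inv_smul₀ (hs0 x)]
  have hn1 : ∀ x, ‖n x‖ = 1 := by
    intro x
    simp only [hn, norm_smul, norm_inv, hs, norm_norm]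
    exact inv_mul_cancel₀ (hs0 x)
  have hfd : ∀ x y, fderiv ℝ v x y = s x • fderiv ℝ n x y + (fderiv ℝ s x y) • n x := by
    intro x y
    have h1 := ((hsd x).hasFDerivAt.smul (hnd x).hasFDerivAt).fderiv
    have h3 : v = s • n := hvn
    have h2 : fderiv ℝ v x = s x • fderiv ℝ n x + (fderiv ℝ s x).smulRight (n x) := by
      rw [← h1, ← h3]
    rw [h2]
    simp
  have horth : ∀ x y, inner ℝ (n x) (fderiv ℝ n x y) = (0:ℝ) := by
    intro x y
    have h1 := (hnd x).hasFDerivAt.norm_sq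
    have h2 : (fun x => ‖n x‖ ^ 2) = fun _ => (1:ℝ) := by ext x; simp [hn1]
    rw [h2] at h1
    have h3 := h1.unique (hasFDerivAt_const (1:ℝ) x)
    have h4 := DFunLike.congr_fun h3 y
    simpa using h4
  have hnorm : ∀ x y, ‖fderiv ℝ v x y‖ ^ 2 = (fderiv ℝ s x y) ^ 2 + s x ^ 2 * ‖fderiv ℝ n x y‖ ^ 2 := by
    intro x y
    rw [hfd, norm_add_sq_real, norm_smul, norm_smul, inner_smul_left, inner_smul_right,
      real_inner_comm, horth, hn1]
    simp only [Real.norm_eq_abs, mul_pow, sq_abs]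
    simp
    ring
  have hg : ∀ x, gradSq v x = sgrad s x + s x ^ 2 * gradSq n x := by
    intro x
    simp only [gradSq, sgrad, Fin.sum_univ_two, hnorm]
    ring
  have hgn : ∀ x, 0 ≤ gradSq n x := fun x => Finset.sum_nonneg fun i _ => sq_nonneg _
  have isg : Integrable (sgrad s) := by
    refine hv.ig.mono' (measurable_sgrad _).aestronglyMeasurable (Eventually.of_forall fun x => ?_)
    rw [Real.norm_of_nonneg (sgrad_nonneg _ _), hg]
    have := mul_nonneg (sq_nonneg (s x)) (hgn x)
    linarith
  have hge := scalar_ge ε μ f v hv.ismin s hsd hv.i2 isg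
  have isd := sden_integrable ε μ hμc C hC s hv.i2 hv.i4 isg
  have iv := hv.vden_integrable hμc C hC
  have hdiff : ∀ x, s x ^ 2 * gradSq n x = 2 * (vden ε μ v x - sden ε μ s x) := by
    intro x
    simp only [vden, sden, hg]
    ring
  have iq : Integrable fun x => s x ^ 2 * gradSq n x := by
    simp only [hdiff]
    exact (iv.sub isd).const_mul 2
  have hq0 : ∫ x, s x ^ 2 * gradSq n x ≤ 0 := by
    simp only [hdiff]
    rw [integral_const_mul, integral_sub iv isd]
    linarith
  have hqn : ∀ x, 0 ≤ s x ^ 2 * gradSq n x := fun x => mul_nonneg (sq_nonneg _) (hgn x)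
  have hq : (fun x => s x ^ 2 * gradSq n x) =ᵐ[volume] 0 :=
    (integral_eq_zero_iff_of_nonneg hqn iq).1 (le_antisymm hq0 (integral_nonneg hqn))
  have hae : ∀ᵐ x, fderiv ℝ n x = 0 := by
    filter_upwards [hq] with x hx
    have h1 : gradSq n x = 0 := by
      rcases mul_eq_zero.1 hx with h | h
      · exact absurd (pow_eq_zero_iff two_ne_zero |>.1 h) (hs0 x)
      · exact h
    have h2 := opNorm_sq_le (fderiv ℝ n x)
    have h3 : ‖fderiv ℝ n x‖ ^ 2 ≤ 0 := by
      simp only [gradSq] at h1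
      rw [h1] at h2
      linarith
    have h4 : ‖fderiv ℝ n x‖ = 0 := by nlinarith [norm_nonneg (fderiv ℝ n x)]
    exact norm_eq_zero.1 h4
  refine ⟨n 0, hn1 0, fun x => ?_⟩
  rw [← const_of_ae_fderiv_zero n hnd hae x 0]
  exact congrFun hvn x

lemma exists_rotation (e e' : E2) (he : ‖e‖ = 1) (he' : ‖e'‖ = 1) :
    ∃ g : E2 ≃ₗᵢ[ℝ] E2, LinearMap.det (g.toLinearEquiv.toLinearMap) = 1 ∧ g e = e' := by
  have h1 : e 0 ^ 2 + e 1 ^ 2 = 1 := by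
    have := EuclideanSpace.norm_sq_eq e
    rw [he] at this
    simpa [Fin.sum_univ_two] using this.symm
  have h2 : e' 0 ^ 2 + e' 1 ^ 2 = 1 := by
    have := EuclideanSpace.norm_sq_eq e'
    rw [he'] at this
    simpa [Fin.sum_univ_two] using this.symm
  set c := e 0 * e' 0 + e 1 * e' 1 with hc
  set d := e 0 * e' 1 - e 1 * e' 0 with hd
  have hcd : c ^ 2 + d ^ 2 = 1 := by
    have : c ^ 2 + d ^ 2 = (e 0 ^ 2 + e 1 ^ 2) * (e' 0 ^ 2 + e' 1 ^ 2) := by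
      simp only [hc, hd]; ring
    rw [this, h1, h2, one_mul]
  set A : Matrix (Fin 2) (Fin 2) ℝ := !![c, -d; d, c] with hA
  set L : E2 →ₗ[ℝ] E2 := Matrix.toEuclideanLin A with hL
  have hL0 : ∀ x, L x 0 = c * x 0 - d * x 1 := by
    intro x
    simp [hL, hA, Matrix.toEuclideanLin, Matrix.mulVec, dotProduct, Fin.sum_univ_two]
    try ring
  have hL1 : ∀ x, L x 1 = d * x 0 + c * x 1 := by
    intro x
    simp [hL, hA, Matrix.toEuclideanLin, Matrix.mulVec, dotProduct, Fin.sum_univ_two]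
    try ring
  have hiso : ∀ x, ‖L x‖ = ‖x‖ := by
    intro x
    have h3 : ‖L x‖ ^ 2 = ‖x‖ ^ 2 := by
      rw [EuclideanSpace.norm_sq_eq, EuclideanSpace.norm_sq_eq]
      simp only [Fin.sum_univ_two, hL0, hL1, Real.norm_eq_abs, sq_abs]
      have : (c * x 0 - d * x 1) ^ 2 + (d * x 0 + c * x 1) ^ 2
        = (c ^ 2 + d ^ 2) * (x 0 ^ 2 + x 1 ^ 2) := by ring
      rw [this, hcd, one_mul]
    exact (pow_left_inj₀ (norm_nonneg _) (norm_nonneg _) two_ne_zero).1 h3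
  set I : E2 →ₗᵢ[ℝ] E2 := ⟨L, hiso⟩ with hI
  refine ⟨I.toLinearIsometryEquiv rfl, ?_, ?_⟩
  · have h3 : (I.toLinearIsometryEquiv rfl).toLinearEquiv.toLinearMap = L := by
      ext x : 1
      rfl
    rw [h3, hL, Matrix.toEuclideanLin_eq_toLin, LinearMap.det_toLin, hA, Matrix.det_fin_two_of]
    linarith
  · have h3 : I.toLinearIsometryEquiv rfl e = L e := rfl
    rw [h3]
    ext i
    fin_cases i
    · change L e 0 = e' 0
      rw [hL0]
      linear_combination (e' 0) * h1
    · change L e 1 = e' 1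
      rw [hL1]
      linear_combination (e' 1) * h1

lemma main_form {ε : ℝ} {μ : E2 → ℝ} {f v : E2 → E2} {μrad : ℝ → ℝ} {ρ : ℝ} (hε : 0 < ε)
    (hμ : MuHyp μ μrad ρ) (hv : GoodMin ε μ f v) (hneg : ∫ x, vden ε μ v x < 0) :
    ∃ (e : E2) (vrad : ℝ → ℝ), ‖e‖ = 1 ∧ ContDiff ℝ (⊤ : ℕ∞) vrad ∧
      (∀ r : ℝ, 0 < vrad r) ∧ (∀ x : E2, v x = vrad ‖x‖ • e) := by
  obtain ⟨C, hC⟩ := hμ.bdd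
  have hμc : Continuous μ := hμ.smooth.continuous
  have hμrc : Continuous μrad := hμ.smooth_rad.continuous
  have hrad : ∀ x y : E2, ‖x‖ = ‖y‖ → ‖v x‖ = ‖v y‖ := by
    intro x y hxy
    set R : E2 ≃ₗᵢ[ℝ] E2 := (ℝ ∙ (x - y))ᗮ.reflection with hR
    have hRx : R x = y := Submodule.reflection_sub hxy
    have hmin := isMin_rot ε μ f v R (fun z => by
      rw [hμ.radial, hμ.radial, R.norm_map]) hv.ismin
    have hneg' : ∫ z, vden ε μ (fun z => v (R z)) z < 0 := by
      have h1 := hmin.2 v hv.ismin.1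
      rw [energy_zero, energy_zero] at h1
      linarith
    have hg := goodMin_of ε hε μ f _ hμc C hC hmin hneg'
    have := norm_eq_of_min hε hμc hC hv hg x
    rw [this, hRx]
  set h : ℝ → ℝ := fun r => ‖v (r • e2basis 0)‖ with hh
  have hvr : ∀ x, ‖v x‖ = h ‖x‖ := by
    intro x
    apply hrad
    simp [norm_smul, norm_e2basis]
  have hev : ∀ r, h (-r) = h r := by
    intro r
    apply hrad
    simp
  have hhc : Continuous h := (hv.diff.continuous.comp (continuous_id.smul continuous_const)).norm
  set p : ℝ → ℝ := fun r => (1/ε^2) * (h r ^ 2 - μrad r) with hp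
  have hpc : Continuous p := by fun_prop
  obtain ⟨c, hc⟩ := integral_eq_of_weak h (fun r => p r * h r) hhc (hpc.mul hhc) hev
    (fun r => by simp only [hp, hev, hμ.even_rad])
    (fun χ a R hχ ha haR hsupp hmean =>
      weak_radial hε hC hμc hμrc hμ.radial hv (fun _ => rfl) hvr χ a R hχ ha haR hsupp hmean)
  have hsm : ContDiff ℝ (⊤ : ℕ∞) h := by
    refine smooth_of_integral_eq h (fun r => p r * h r) c hhc (fun n hn => ?_) hc
    have hμn : ContDiff ℝ n μrad := hμ.smooth_rad.of_le (by exact_mod_cast le_top)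
    simp only [hp]
    fun_prop
  have hpos : ∀ r, 0 < h r := by
    intro r
    by_contra hcon
    have hr : h r = 0 := le_antisymm (not_lt.1 hcon) (norm_nonneg _)
    have hz := zero_of_zero h p c hpc hsm hev (fun _ => norm_nonneg _) hc r hr
    have hv0 : v = fun _ => 0 := by
      ext1 x
      have := hvr x
      rw [hz] at this
      exact norm_eq_zero.1 this
    rw [hv0] at hneg
    simp [vden, gradSq] at hneg
  obtain ⟨e, he, hve⟩ := dir_const hC hμc hv (fun x => by
    rw [← norm_ne_zero_iff, hvr]; exact (hpos _).ne')
  refine ⟨e, h, he, hsm, hpos, fun x => ?_⟩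
  rw [← hvr]
  exact hve x

/-- for `a = 0` and `ε` small, every global minimizer is of the form
`v(x) = v_rad(|x|) • e` for a unit vector `e` (i.e. a rotation of `(v_rad(|x|),0)`)
with `v_rad` smooth and positive, and the global minimizer is unique up to
composing with a rotation `g ∈ SO(2)` in the target. -/
theorem statement7
    (μ : E2 → ℝ) (μrad : ℝ → ℝ) (ρ : ℝ) (f : E2 → E2) (frad : ℝ → ℝ)
    (hμ : MuHyp μ μrad ρ) (hf : FHyp f frad) :
    ∃ ε₀ : ℝ, 0 < ε₀ ∧ ∀ ε : ℝ, 0 < ε → ε < ε₀ →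
      (∀ v : E2 → E2, IsMinimizer ε 0 μ f v →
        ∃ (e : E2) (vrad : ℝ → ℝ), ‖e‖ = 1 ∧ ContDiff ℝ (⊤ : ℕ∞) vrad ∧
          (∀ r : ℝ, 0 < vrad r) ∧ ∀ x : E2, v x = vrad ‖x‖ • e) ∧
      (∀ v w : E2 → E2, IsMinimizer ε 0 μ f v → IsMinimizer ε 0 μ f w →
        ∃ g : E2 ≃ₗᵢ[ℝ] E2, LinearMap.det (g.toLinearEquiv.toLinearMap) = 1 ∧
          ∀ x : E2, w x = g (v x)) := by
  obtain ⟨C, hC⟩ := hμ.bdd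
  have hμc : Continuous μ := hμ.smooth.continuous
  obtain ⟨ε₀, hε₀, hneg⟩ := exists_neg μ μrad ρ hμ
  refine ⟨ε₀, hε₀, fun ε hε hεlt => ?_⟩
  have hgood : ∀ v, IsMinimizer ε 0 μ f v → GoodMin ε μ f v := fun v hv =>
    goodMin_of ε hε μ f v hμc C hC hv (hneg ε hε hεlt f v hv)
  have hform : ∀ v : E2 → E2, IsMinimizer ε 0 μ f v →
        ∃ (e : E2) (vrad : ℝ → ℝ), ‖e‖ = 1 ∧ ContDiff ℝ (⊤ : ℕ∞) vrad ∧
          (∀ r : ℝ, 0 < vrad r) ∧ ∀ x : E2, v x = vrad ‖x‖ • e := fun v hv =>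
    main_form hε hμ (hgood v hv) (hneg ε hε hεlt f v hv)
  refine ⟨hform, fun v w hv hw => ?_⟩
  obtain ⟨e, h, he, -, hpos, hve⟩ := hform v hv
  obtain ⟨e', h', he', -, hpos', hwe⟩ := hform w hw
  obtain ⟨g, hdet, hge⟩ := exists_rotation e e' he he'
  refine ⟨g, hdet, fun x => ?_⟩
  have h1 := norm_eq_of_min hε hμc hC (hgood v hv) (hgood w hw) x
  rw [hve, hwe, norm_smul, norm_smul, he, he', mul_one, mul_one, Real.norm_of_nonneg (hpos _).le,
    Real.norm_of_nonneg (hpos' _).le] at h1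
  rw [hve, hwe, map_smul, hge, h1]
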